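/- arXiv:1107.4791 — 2 statements merged into one kernel-verified Lean document; each statement's English description precedes it below -/
import Mathlib

section
/- The set of eigenvalues of the problem (α,β) is infinite, and for every real constant C the set of eigenvalues of the problem (α,β) not exceeding C is finite; consequently the spectrum is a sequence of eigenvalues tending to +∞. -/
open Set Filter

/-- First derivative on `[0,1]` (one-sided at the endpoints). -/
noncomputable def Y1 (y : ℝ → ℝ) : ℝ → ℝ := derivWithin y (Set.Icc 0 1)
/-- Second derivative on `[0,1]`. -/
noncomputable def Y2 (y : ℝ → ℝ) : ℝ → ℝ := iteratedDerivWithin 2 y (Set.Icc 0 1)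
/-- Third derivative on `[0,1]`. -/
noncomputable def Y3 (y : ℝ → ℝ) : ℝ → ℝ := iteratedDerivWithin 3 y (Set.Icc 0 1)

/-- `y` is a solution on `[0,1]` of `[y''' - λ P y]' + λ P y' = 0`:
`y ∈ C³[0,1]` and `y''' - λ P y` is (continuously) differentiable on `[0,1]`
with derivative `-λ P y'`. -/
def SolutionOn (P : ℝ → ℝ) (lam : ℝ) (y : ℝ → ℝ) : Prop :=
  ContDiffOn ℝ 3 y (Set.Icc 0 1) ∧
  ∀ x ∈ Set.Icc (0:ℝ) 1,
    HasDerivWithinAt (fun t => Y3 y t - lam * P t * y t)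
      (-(lam * P x * Y1 y x)) (Set.Icc 0 1) x

/-- `y` is not identically zero on `[0,1]`. -/
def Nontrivial01 (y : ℝ → ℝ) : Prop := ∃ x ∈ Set.Icc (0:ℝ) 1, y x ≠ 0

/-- The boundary conditions of the problem `(α, β)`. -/
def BC (α β : ℝ) (y : ℝ → ℝ) : Prop :=
  Y2 y 0 + α * y 0 - β * Y1 y 0 = 0 ∧
  -β * Y3 y 0 + α * Y2 y 0 = 0 ∧
  Y2 y 1 + α * y 1 + β * Y1 y 1 = 0 ∧
  -β * Y3 y 1 - α * Y2 y 1 = 0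

/-- `y` is an eigenfunction of the problem `(α, β)` with eigenvalue `lam`. -/
def Eigenfunction (P : ℝ → ℝ) (α β lam : ℝ) (y : ℝ → ℝ) : Prop :=
  Nontrivial01 y ∧ SolutionOn P lam y ∧ BC α β y

/-- `lam` is an eigenvalue of the problem `(α, β)`. -/
def IsEigenvalue (P : ℝ → ℝ) (α β lam : ℝ) : Prop :=
  ∃ y : ℝ → ℝ, Eigenfunction P α β lam y

/-- The number `b = (1 - κ a)/(κ - 1)`. -/
noncomputable def bb (κ : ℕ) (a : ℝ) : ℝ := (1 - κ * a) / (κ - 1)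

/-- `P` is a nondecreasing continuous function on `[0,1]` with `P 0 = 0`, `P 1 = 1`,
self-similar of Cantor type with parameters `κ ≥ 2` and `0 < a < 1/κ`. -/
def CantorSelfSimilar (P : ℝ → ℝ) (κ : ℕ) (a : ℝ) : Prop :=
  ContinuousOn P (Set.Icc 0 1) ∧ MonotoneOn P (Set.Icc 0 1) ∧
  P 0 = 0 ∧ P 1 = 1 ∧ 2 ≤ κ ∧ 0 < a ∧ a < 1 / κ ∧
  (∀ k : ℕ, k < κ → ∃ c : ℝ, ∀ x ∈ Set.Icc (0:ℝ) 1,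
      (κ : ℝ) * P (k * (a + bb κ a) + a * x) = P x + c) ∧
  (∀ k : ℕ, 1 ≤ k → k < κ →
      ∀ x ∈ Set.Ioo ((k:ℝ) * (a + bb κ a) - bb κ a) ((k:ℝ) * (a + bb κ a)),
      ∀ x' ∈ Set.Ioo ((k:ℝ) * (a + bb κ a) - bb κ a) ((k:ℝ) * (a + bb κ a)),
      P x = P x')

open scoped InnerProductSpace in
theorem exists_continuousLinearEquiv_of_coercive {V : Type*} [NormedAddCommGroup V]
    [InnerProductSpace ℝ V] [CompleteSpace V] (A : V →L[ℝ] V) {c : ℝ} (hc : 0 < c)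
    (hA : ∀ v, c * ‖v‖ ^ 2 ≤ ⟪A v, v⟫_ℝ) : ∃ e : V ≃L[ℝ] V, ∀ v, e v = A v := by
  let B : V →L[ℝ] V →L[ℝ] ℝ := LinearMap.mkContinuous₂
    (LinearMap.mk₂ ℝ (fun u v => ⟪A u, v⟫_ℝ)
      (by intros; simp [inner_add_left]) (by intros; simp [inner_smul_left])
      (by intros; simp [inner_add_right]) (by intros; simp [inner_smul_right])) ‖A‖
    (fun u v => (norm_inner_le_norm _ _).trans (by gcongr; exact A.le_opNorm u))
  have hB : IsCoercive B := ⟨c, hc, fun u => by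
    have h := hA u
    rw [sq, ← mul_assoc] at h
    exact h⟩
  refine ⟨hB.continuousLinearEquivOfBilin, fun v => ?_⟩
  exact (hB.unique_continuousLinearEquivOfBilin (fun w => rfl)).symm

namespace GeneralizedEigenvalue

open scoped InnerProductSpace

variable {V H : Type*} [NormedAddCommGroup V] [InnerProductSpace ℝ V]
  [NormedAddCommGroup H] [InnerProductSpace ℝ H]

/-- The eigenvalues of the symmetric pencil `⟪A u, v⟫ = s ⟪J u, J v⟫`. -/
def pencilEigenvalues (A : V →L[ℝ] V) (J : V →L[ℝ] H) : Set ℝ :=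
  {s | ∃ u ≠ 0, ∀ v, ⟪A u, v⟫_ℝ = s * ⟪J u, J v⟫_ℝ}

variable {A : V →L[ℝ] V} {J : V →L[ℝ] H} {c : ℝ}

theorem finite_pencilEigenvalues_le (hc : 0 < c)
    (hA : ∀ v, c * ‖v‖ ^ 2 ≤ ⟪A v, v⟫_ℝ) (hsymm : ∀ u v, ⟪A u, v⟫_ℝ = ⟪A v, u⟫_ℝ)
    (hJ : IsCompactOperator J) (C : ℝ) : (pencilEigenvalues A J ∩ Iic C).Finite := by
  by_contra hinf
  have key : ∀ s ∈ pencilEigenvalues A J ∩ Iic C, ∃ u : V, ‖J u‖ = 1 ∧ c * ‖u‖ ^ 2 ≤ C ∧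
      ∀ v, ⟪A u, v⟫_ℝ = s * ⟪J u, J v⟫_ℝ := by
    rintro s ⟨⟨u, hu0, hu⟩, hsC⟩
    have hpos : 0 < c * ‖u‖ ^ 2 := by positivity
    have hJu : ‖J u‖ ≠ 0 := by
      intro h
      have h1 := hA u
      rw [hu u, real_inner_self_eq_norm_sq, h] at h1
      simp at h1
      linarith
    have hw : ∀ v, ⟪A ((‖J u‖)⁻¹ • u), v⟫_ℝ = s * ⟪J ((‖J u‖)⁻¹ • u), J v⟫_ℝ := by
      intro v
      simp only [map_smul, inner_smul_left, hu v]
      ring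
    have hn : ‖J ((‖J u‖)⁻¹ • u)‖ = 1 := by
      rw [map_smul, norm_smul, norm_inv, norm_norm, inv_mul_cancel₀ hJu]
    refine ⟨(‖J u‖)⁻¹ • u, hn, ?_, hw⟩
    refine (hA _).trans ?_
    rw [hw, real_inner_self_eq_norm_sq, hn]
    simpa using hsC
  let g := (Set.Infinite.natEmbedding _ hinf)
  choose U hU1 hU2 hU3 using fun n : ℕ => key (g n) (g n).2
  have hb : ∀ n, U n ∈ Metric.closedBall (0 : V) (√(C / c)) := by
    intro n
    rw [mem_closedBall_zero_iff]
    apply Real.le_sqrt_of_sq_le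
    rw [le_div_iff₀ hc]
    linarith [hU2 n]
  obtain ⟨K, hK, hKs⟩ := hJ.image_closedBall_subset_compact (f := J.toLinearMap) (√(C / c))
  obtain ⟨x, -, φ, hφ, hlim⟩ := hK.tendsto_subseq
    (x := fun n => J (U n)) (fun n => hKs ⟨U n, hb n, rfl⟩)
  have horth : ∀ m n, m ≠ n → ⟪J (U m), J (U n)⟫_ℝ = 0 := by
    intro m n hmn
    have h1 := hU3 m (U n)
    rw [hsymm, hU3 n (U m), real_inner_comm] at h1
    have h2 : ((g n : ℝ) - g m) * ⟪J (U m), J (U n)⟫_ℝ = 0 := by linarith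
    rcases mul_eq_zero.1 h2 with h | h
    · exact absurd (g.injective (Subtype.ext (sub_eq_zero.1 h))) hmn.symm
    · exact h
  obtain ⟨N, hN⟩ := Metric.cauchySeq_iff.1 hlim.cauchySeq 1 one_pos
  have h := hN N le_rfl (N + 1) (Nat.le_succ N)
  have hne : φ N ≠ φ (N + 1) := (hφ (Nat.lt_succ_self N)).ne
  have h2 := norm_sub_sq_real (J (U (φ N))) (J (U (φ (N + 1))))
  rw [horth _ _ hne, hU1, hU1] at h2
  rw [dist_eq_norm] at h
  simp only [Function.comp] at h
  nlinarith [norm_nonneg (J (U (φ N)) - J (U (φ (N + 1))))]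

variable [CompleteSpace V] [CompleteSpace H]

theorem infinite_pencilEigenvalues (hc : 0 < c)
    (hA : ∀ v, c * ‖v‖ ^ 2 ≤ ⟪A v, v⟫_ℝ) (hsymm : ∀ u v, ⟪A u, v⟫_ℝ = ⟪A v, u⟫_ℝ)
    (hJ : IsCompactOperator J) (hrange : ¬ FiniteDimensional ℝ J.range) :
    (pencilEigenvalues A J).Infinite := by
  intro hfin
  apply hrange
  obtain ⟨e, he⟩ := exists_continuousLinearEquiv_of_coercive A hc hA
  have hes : ∀ v, A (e.symm v) = v := fun v => by rw [← he, e.apply_symm_apply]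
  let T : H →L[ℝ] H := J ∘L (e.symm : V →L[ℝ] V) ∘L ContinuousLinearMap.adjoint J
  have hTf : ∀ f, T f = J (e.symm (ContinuousLinearMap.adjoint J f)) := fun f => rfl
  have hTi : ∀ f g, ⟪T f, g⟫_ℝ = ⟪A (e.symm (ContinuousLinearMap.adjoint J g)),
      e.symm (ContinuousLinearMap.adjoint J f)⟫_ℝ := by
    intro f g
    rw [hes, ContinuousLinearMap.adjoint_inner_left, real_inner_comm]
    rfl
  have hTc : IsCompactOperator T := hJ.comp_clm _
  have hTs : (T : H →ₗ[ℝ] H).IsSymmetric := by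
    intro f g
    change ⟪T f, g⟫_ℝ = ⟪f, T g⟫_ℝ
    rw [← real_inner_comm f (T g), hTi, hTi, hsymm]
  let E : Set ℝ := {ν | ν ≠ 0 ∧ Module.End.HasEigenvalue (T : Module.End ℝ H) ν}
  have hE : E.Finite := by
    refine Set.Finite.of_finite_image (f := fun x => x⁻¹) (hfin.subset ?_)
      inv_injective.injOn
    rintro _ ⟨ν, ⟨hν0, hν⟩, rfl⟩
    obtain ⟨f, hf⟩ := hν.exists_hasEigenvector
    have hTf' : T f = ν • f := hf.apply_eq_smul
    have hJu : J (e.symm (ContinuousLinearMap.adjoint J f)) = ν • f := hTf'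
    refine ⟨e.symm (ContinuousLinearMap.adjoint J f), ?_, fun v => ?_⟩
    · intro h0
      rw [h0, map_zero] at hJu
      exact (smul_ne_zero hν0 hf.2) hJu.symm
    · rw [hes, hJu, ContinuousLinearMap.adjoint_inner_left, inner_smul_left]
      simp [hν0]
  let W : Submodule ℝ H := ⨆ ν ∈ E, Module.End.eigenspace (T : Module.End ℝ H) ν
  have hW : FiniteDimensional ℝ W := by
    have : Finite E := hE
    have : ∀ ν : E, FiniteDimensional ℝ (Module.End.eigenspace (T : Module.End ℝ H) ν) :=
      fun ν => ContinuousLinearMap.finite_dimensional_eigenspace hTc _ ν.2.1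
    have h : W = ⨆ ν : E, Module.End.eigenspace (T : Module.End ℝ H) ν := iSup_subtype'
    rw [h]
    infer_instance
  have hinj : ∀ u : V, J u ∈ Wᗮ → J u = 0 := by
    intro u hu
    have hbot := ContinuousLinearMap.orthogonalComplement_iSup_eigenspaces_eq_bot hTc hTs
    rw [← Submodule.mem_bot ℝ, ← hbot, ← Submodule.iInf_orthogonal, Submodule.mem_iInf]
    intro ν
    by_cases hν0 : ν = 0
    · subst hν0
      rw [Submodule.mem_orthogonal]
      intro f hf
      have hf0 : T f = 0 := by
        simpa using Module.End.mem_eigenspace_iff.1 hf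
      have h1 := hA (e.symm (ContinuousLinearMap.adjoint J f))
      rw [← hTi, hf0, inner_zero_left] at h1
      have h2 : e.symm (ContinuousLinearMap.adjoint J f) = 0 := by
        by_contra h
        have : 0 < c * ‖e.symm (ContinuousLinearMap.adjoint J f)‖ ^ 2 := by positivity
        linarith
      have h3 : ContinuousLinearMap.adjoint J f = 0 := by simpa using h2
      rw [← ContinuousLinearMap.adjoint_inner_left, h3, inner_zero_left]
    · by_cases hν : Module.End.HasEigenvalue (T : Module.End ℝ H) ν
      · exact Submodule.orthogonal_le (le_biSup (fun ν =>
          Module.End.eigenspace (T : Module.End ℝ H) ν) (show ν ∈ E from ⟨hν0, hν⟩)) hu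
      · rw [Module.End.hasEigenvalue_iff, not_not] at hν
        rw [hν]
        simp
  let p : J.range →ₗ[ℝ] W := W.orthogonalProjectionOnto.toLinearMap ∘ₗ J.range.subtype
  refine FiniteDimensional.of_injective p ((injective_iff_map_eq_zero p).2 ?_)
  rintro ⟨_, u, rfl⟩ hx
  have : W.orthogonalProjectionOnto (J u) = 0 := hx
  exact Subtype.ext (hinj u (Submodule.orthogonalProjectionOnto_eq_zero_iff.1 this))

end GeneralizedEigenvalue

section Calculus

open MeasureTheory

theorem contDiffOn_one_of_hasDerivWithinAt {f f' : ℝ → ℝ} {s : Set ℝ} (hs : UniqueDiffOn ℝ s)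
    (hf : ∀ x ∈ s, HasDerivWithinAt f (f' x) s x) (hf' : ContinuousOn f' s) :
    ContDiffOn ℝ 1 f s :=
  (contDiffOn_one_iff_derivWithin hs).2
    ⟨fun x hx => (hf x hx).differentiableWithinAt,
      hf'.congr fun x hx => (hf x hx).derivWithin (hs x hx)⟩

theorem hasDerivWithinAt_add_integral {f : ℝ → ℝ} (hf : ContinuousOn f (Icc 0 1)) (c : ℝ)
    {x : ℝ} (hx : x ∈ Icc (0 : ℝ) 1) :
    HasDerivWithinAt (fun x => c + ∫ t in (0 : ℝ)..x, f t) (f x) (Icc 0 1) x := by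
  have hfx : Fact (x ∈ Icc (0 : ℝ) 1) := ⟨hx⟩
  refine HasDerivWithinAt.const_add c ?_
  refine intervalIntegral.integral_hasDerivWithinAt_right ?_
    (hf.stronglyMeasurableAtFilter_nhdsWithin measurableSet_Icc x) (hf x hx)
  refine (hf.mono ?_).intervalIntegrable
  rw [uIcc_of_le hx.1]
  exact Icc_subset_Icc_right hx.2

/-- The fundamental theorem of calculus on `[0, x] ⊆ [0, 1]`. -/
theorem eq_add_integral_of_hasDerivWithinAt {f f' : ℝ → ℝ}
    (hf : ∀ x ∈ Icc (0 : ℝ) 1, HasDerivWithinAt f (f' x) (Icc 0 1) x)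
    (hf' : ContinuousOn f' (Icc 0 1)) {x : ℝ} (hx : x ∈ Icc (0 : ℝ) 1) :
    f x = f 0 + ∫ t in (0 : ℝ)..x, f' t := by
  have hsub : Icc 0 x ⊆ Icc (0 : ℝ) 1 := Icc_subset_Icc_right hx.2
  rw [intervalIntegral.integral_eq_sub_of_hasDerivAt_of_le hx.1
    (fun t ht => ((hf t (hsub ht)).continuousWithinAt).mono hsub)
    (fun t ht => (hf t (hsub (Ioo_subset_Icc_self ht))).hasDerivAt
      (Icc_mem_nhds ht.1 (ht.2.trans_le hx.2)))
    ((hf'.mono (by rwa [uIcc_of_le hx.1])).intervalIntegrable)]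
  ring

/-- Integration by parts for the product of a `C¹` function with the primitive of an integrable
function. -/
theorem integral_mul_eq_sub_of_primitive {m m' w D : ℝ → ℝ} {q : ℝ}
    (hm : ∀ x ∈ Icc (0 : ℝ) 1, HasDerivWithinAt m (m' x) (Icc 0 1) x)
    (hm' : ContinuousOn m' (Icc 0 1)) (hw : IntervalIntegrable w volume 0 1)
    (hD : ∀ x ∈ Icc (0 : ℝ) 1, D x = q + ∫ t in (0 : ℝ)..x, w t) :
    ∫ x in (0 : ℝ)..1, m x * w x = m 1 * D 1 - m 0 * D 0 - ∫ x in (0 : ℝ)..1, m' x * D x := by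
  let F : ℝ → ℝ := fun x => ∫ t in (0 : ℝ)..x, w t
  have hI : uIcc (0 : ℝ) 1 = Icc 0 1 := uIcc_of_le zero_le_one
  have hmac : AbsolutelyContinuousOnInterval m 0 1 := by
    apply ContDiffOn.absolutelyContinuousOnInterval
    rw [hI]
    exact contDiffOn_one_of_hasDerivWithinAt (uniqueDiffOn_Icc zero_lt_one) hm hm'
  have hFac : AbsolutelyContinuousOnInterval F 0 1 :=
    hw.absolutelyContinuousOnInterval_intervalIntegral (by simp)
  have h := hmac.integral_mul_deriv_eq_deriv_mul hFac
  have h1 : ∫ x in (0 : ℝ)..1, m x * deriv F x = ∫ x in (0 : ℝ)..1, m x * w x := by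
    apply intervalIntegral.integral_congr_ae
    filter_upwards [hw.ae_hasDerivAt_integral] with x hx hxI
    rw [(hx (uIoc_subset_uIcc hxI) 0 (by simp)).deriv]
  have h2 : ∫ x in (0 : ℝ)..1, deriv m x * F x
      = (∫ x in (0 : ℝ)..1, m' x * D x) - q * (m 1 - m 0) := by
    have h3 := eq_add_integral_of_hasDerivWithinAt hm hm' (x := 1) (by simp)
    have hDc : ContinuousOn D (Icc 0 1) := by
      refine ContinuousOn.congr (f := fun x => q + F x) ?_ hD
      exact continuousOn_const.add (hI ▸ hFac.continuousOn)
    have hm'i : IntervalIntegrable m' volume 0 1 := hm'.intervalIntegrable_of_Icc zero_le_one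
    rw [show m 1 - m 0 = ∫ t in (0 : ℝ)..1, m' t by linarith,
      ← intervalIntegral.integral_const_mul, ← intervalIntegral.integral_sub
        ((hm'.fun_mul hDc).intervalIntegrable_of_Icc zero_le_one) (hm'i.const_mul q)]
    apply intervalIntegral.integral_congr_ae
    filter_upwards [measure_eq_zero_iff_ae_notMem.1 (measure_singleton (μ := volume) (1 : ℝ))] with x hx1 hxI
    rw [uIoc_of_le zero_le_one] at hxI
    have hx : x ∈ Ioo (0 : ℝ) 1 := ⟨hxI.1, lt_of_le_of_ne hxI.2 hx1⟩
    rw [((hm x (Ioo_subset_Icc_self hx)).hasDerivAt (Icc_mem_nhds hx.1 hx.2)).deriv,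
      hD x (Ioo_subset_Icc_self hx)]
    simp only [F]
    ring
  have hD0 := hD 0 (by simp)
  have hD1 := hD 1 (by simp)
  rw [h1, h2] at h
  have hF0 : F 0 = 0 := by simp [F]
  have hF1 : F 1 = D 1 - q := by simp [F, hD1]
  simp only [intervalIntegral.integral_same, add_zero] at hD0
  rw [h, hF0, hF1, hD0]
  ring

end Calculus

section StieltjesMeasure

open MeasureTheory unitInterval

/-- Integration by parts against the Stieltjes measure of a continuous function. -/
theorem StieltjesFunction.setIntegral_Ioc_eq_sub (F : StieltjesFunction ℝ) (hF : Continuous F)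
    {g g' : ℝ → ℝ} (hg : ∀ x ∈ Icc (0 : ℝ) 1, HasDerivWithinAt g (g' x) (Icc 0 1) x)
    (hg' : ContinuousOn g' (Icc 0 1)) :
    ∫ s in Ioc (0 : ℝ) 1, g s ∂F.measure
      = g 1 * F 1 - g 0 * F 0 - ∫ x in (0 : ℝ)..1, F x * g' x := by
  have hI : uIcc (0 : ℝ) 1 = Icc 0 1 := uIcc_of_le zero_le_one
  have hg'i : IntervalIntegrable g' volume 0 1 := hg'.intervalIntegrable_of_Icc zero_le_one
  have hFg'i : IntervalIntegrable (fun x => F x * g' x) volume 0 1 :=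
    (hF.continuousOn.fun_mul hg').intervalIntegrable_of_Icc zero_le_one
  have hgc : ContinuousOn g (Icc 0 1) := fun x hx => (hg x hx).continuousWithinAt
  have : IsFiniteMeasure (F.measure.restrict (Ioc (0 : ℝ) 1)) :=
    ⟨by rw [Measure.restrict_apply_univ, F.measure_Ioc]; exact ENNReal.ofReal_lt_top⟩
  let κ : ℝ × ℝ → ℝ := (({p : ℝ × ℝ | p.2 < p.1}).indicator fun p => g' p.1)
  have hκ : Integrable κ ((volume.restrict (Ioc (0 : ℝ) 1)).prod
      (F.measure.restrict (Ioc (0 : ℝ) 1))) := by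
    refine Integrable.indicator ?_ (measurableSet_lt measurable_snd measurable_fst)
    exact Integrable.comp_fst ((intervalIntegrable_iff_integrableOn_Ioc_of_le zero_le_one).1 hg'i) _
  have hswap : ∫ x in Ioc (0 : ℝ) 1, (∫ s in Ioc (0 : ℝ) 1, κ (x, s) ∂F.measure)
      = ∫ s in Ioc (0 : ℝ) 1, (∫ x in Ioc (0 : ℝ) 1, κ (x, s)) ∂F.measure :=
    integral_integral_swap (f := fun x s => κ (x, s)) hκ
  have h1 : ∀ x ∈ Ioc (0 : ℝ) 1, ∫ s in Ioc (0 : ℝ) 1, κ (x, s) ∂F.measure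
      = F x * g' x - F 0 * g' x := by
    intro x hx
    have : ∀ s, κ (x, s) = (Iio x).indicator (fun _ => g' x) s := fun s => rfl
    simp only [this]
    rw [integral_indicator measurableSet_Iio, Measure.restrict_restrict measurableSet_Iio,
      integral_const, show Iio x ∩ Ioc 0 1 = Ioo 0 x by
        ext t; simp only [mem_inter_iff, mem_Iio, mem_Ioc, mem_Ioo]
        exact ⟨fun h => ⟨h.2.1, h.1⟩, fun h => ⟨h.2, h.1, h.2.le.trans hx.2⟩⟩]
    rw [measureReal_restrict_apply_univ, measureReal_def, F.measure_Ioo,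
      hF.continuousAt.continuousWithinAt.leftLim_eq,
      ENNReal.toReal_ofReal (sub_nonneg.2 (F.mono hx.1.le)), smul_eq_mul]
    ring
  have h2 : ∀ s ∈ Ioc (0 : ℝ) 1, ∫ x in Ioc (0 : ℝ) 1, κ (x, s) = g 1 - g s := by
    intro s hs
    have : ∀ x, κ (x, s) = (Ioi s).indicator g' x := fun x => rfl
    simp only [this]
    rw [integral_indicator _root_.measurableSet_Ioi, Measure.restrict_restrict _root_.measurableSet_Ioi,
      show Ioi s ∩ Ioc 0 1 = Ioc s 1 by
        ext t; simp only [mem_inter_iff, mem_Ioi, mem_Ioc]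
        exact ⟨fun h => ⟨h.1, h.2.2⟩, fun h => ⟨h.1, hs.1.trans h.1, h.2⟩⟩,
      ← intervalIntegral.integral_of_le hs.2]
    have hs' : s ∈ Icc (0 : ℝ) 1 := Ioc_subset_Icc_self hs
    have e1 := eq_add_integral_of_hasDerivWithinAt hg hg' hs'
    have e2 := eq_add_integral_of_hasDerivWithinAt hg hg' (x := 1) (by simp)
    have e3 := intervalIntegral.integral_interval_sub_left (a := 0) (b := 1) (c := s) hg'i
      (hg'i.mono_set (by rw [hI, uIcc_of_le hs'.1]; exact Icc_subset_Icc_right hs'.2))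
    linarith
  rw [setIntegral_congr_fun measurableSet_Ioc h1, setIntegral_congr_fun measurableSet_Ioc h2,
    integral_sub (integrable_const _)
      ((hgc.integrableOn_compact isCompact_Icc).mono_set Ioc_subset_Icc_self),
    ← intervalIntegral.integral_of_le zero_le_one,
    intervalIntegral.integral_sub hFg'i (hg'i.const_mul _), intervalIntegral.integral_const_mul,
    integral_const, measureReal_restrict_apply_univ, measureReal_def, F.measure_Ioc,
    ENNReal.toReal_ofReal (sub_nonneg.2 (F.mono zero_le_one)), smul_eq_mul] at hswap
  have e2 := eq_add_integral_of_hasDerivWithinAt hg hg' (x := 1) (by simp)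
  rw [show ∫ x in (0 : ℝ)..1, g' x = g 1 - g 0 by linarith] at hswap
  linarith

/-- The probability measure on `[0, 1]` whose distribution function is `P`. -/
theorem exists_probabilityMeasure_integral_eq {P : ℝ → ℝ} (hPc : ContinuousOn P (Icc 0 1))
    (hPm : MonotoneOn P (Icc 0 1)) (hP0 : P 0 = 0) (hP1 : P 1 = 1) :
    ∃ m : Measure I, IsProbabilityMeasure m ∧ NullSingletonClass m ∧ ∀ g g' : ℝ → ℝ,
      (∀ x ∈ Icc (0 : ℝ) 1, HasDerivWithinAt g (g' x) (Icc 0 1) x) →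
      ContinuousOn g' (Icc 0 1) →
      ∫ x : I, g x ∂m = g 1 - ∫ x in (0 : ℝ)..1, P x * g' x := by
  let Q : ℝ → ℝ := IccExtend zero_le_one ((Icc (0 : ℝ) 1).domRestrict P)
  have hQc : Continuous Q := (continuousOn_iff_continuous_domRestrict.1 hPc).Icc_extend'
  have hQm : Monotone Q := by
    refine Monotone.IccExtend zero_le_one fun x y hxy => ?_
    exact hPm x.2 y.2 hxy
  have hQ : ∀ x ∈ Icc (0 : ℝ) 1, Q x = P x := fun x hx => by
    simp only [Q]
    rw [IccExtend_of_mem _ _ hx]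
    rfl
  let F : StieltjesFunction ℝ := ⟨Q, hQm, fun x => hQc.continuousWithinAt⟩
  have hFc : Continuous F := hQc
  have hF0 : F 0 = 0 := (hQ 0 (by simp)).trans hP0
  have hF1 : F 1 = 1 := (hQ 1 (by simp)).trans hP1
  have hatom : ∀ x, F.measure {x} = 0 := fun x => by
    rw [F.measure_singleton, hFc.continuousAt.continuousWithinAt.leftLim_eq]
    simp
  have hemb : MeasurableEmbedding ((↑) : I → ℝ) := MeasurableEmbedding.subtype_coe measurableSet_Icc
  refine ⟨F.measure.comap (↑), ⟨?_⟩, ⟨fun x => ?_⟩, fun g g' hg hg' => ?_⟩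
  · rw [hemb.comap_apply, image_univ, Subtype.range_coe, F.measure_Icc,
      hFc.continuousAt.continuousWithinAt.leftLim_eq, hF0, hF1]
    simp
  · rw [hemb.comap_apply, image_singleton, hatom]
  · rw [integral_subtype_comap measurableSet_Icc g,
      setIntegral_congr_set (Ioc_ae_eq_Icc' (hatom 0)).symm,
      F.setIntegral_Ioc_eq_sub hFc hg hg', hF0, hF1]
    have : ∫ x in (0 : ℝ)..1, F x * g' x = ∫ x in (0 : ℝ)..1, P x * g' x := by
      apply intervalIntegral.integral_congr
      intro x hx
      rw [uIcc_of_le zero_le_one] at hx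
      exact congrArg (· * g' x) (hQ x hx)
    rw [this]
    ring

end StieltjesMeasure

section EnergySpace

open MeasureTheory unitInterval
open scoped InnerProductSpace

/-- Lebesgue measure on the unit interval, as a measure on `ℝ`. -/
noncomputable abbrev unitVolume : Measure ℝ := volume.restrict (Ioc 0 1)

/-- The triples `(y'', y 0, y' 0)` describing the functions `y` with `y'' ∈ L²(0, 1)`. -/
abbrev EnergySpace : Type := WithLp 2 (Lp ℝ 2 unitVolume × WithLp 2 (ℝ × ℝ))

namespace EnergySpace

instance : IsProbabilityMeasure unitVolume := ⟨by simp⟩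

/-- The element of the energy space with second derivative `w`, initial value `p` and initial
slope `q`. -/
noncomputable def mk (w : Lp ℝ 2 unitVolume) (p q : ℝ) : EnergySpace :=
  WithLp.toLp 2 (w, WithLp.toLp 2 (p, q))

/-- The derivative of the function described by an element of the energy space. -/
noncomputable def slope (v : EnergySpace) (x : ℝ) : ℝ :=
  v.snd.snd + ⟪indicatorConstLp 2 (measurableSet_Iic (a := x)) (measure_ne_top unitVolume _) (1 : ℝ),
    v.fst⟫_ℝ

/-- The function described by an element of the energy space. -/
noncomputable def value (v : EnergySpace) (x : ℝ) : ℝ :=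
  v.snd.fst + ∫ t in (0 : ℝ)..x, slope v t

theorem inner_def (u v : EnergySpace) :
    ⟪u, v⟫_ℝ = ⟪u.fst, v.fst⟫_ℝ + (u.snd.fst * v.snd.fst + u.snd.snd * v.snd.snd) := by
  simp [WithLp.prod_inner_apply, mul_comm]

theorem norm_sq_def (v : EnergySpace) :
    ‖v‖ ^ 2 = ‖v.fst‖ ^ 2 + (v.snd.fst ^ 2 + v.snd.snd ^ 2) := by
  simp [WithLp.prod_norm_sq_eq_of_L2]

theorem norm_fst_le (v : EnergySpace) : ‖v.fst‖ ≤ ‖v‖ := by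
  apply le_of_sq_le_sq ?_ (norm_nonneg _)
  nlinarith [norm_sq_def v, sq_nonneg v.snd.fst, sq_nonneg v.snd.snd]

theorem abs_snd_fst_le (v : EnergySpace) : |v.snd.fst| ≤ ‖v‖ := by
  apply abs_le_of_sq_le_sq ?_ (norm_nonneg _)
  nlinarith [norm_sq_def v, sq_nonneg ‖v.fst‖, sq_nonneg v.snd.snd]

theorem abs_snd_snd_le (v : EnergySpace) : |v.snd.snd| ≤ ‖v‖ := by
  apply abs_le_of_sq_le_sq ?_ (norm_nonneg _)
  nlinarith [norm_sq_def v, sq_nonneg ‖v.fst‖, sq_nonneg v.snd.fst]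

theorem intervalIntegrable_fst (v : EnergySpace) : IntervalIntegrable v.fst volume 0 1 := by
  rw [intervalIntegrable_iff_integrableOn_Ioc_of_le zero_le_one]
  exact (Lp.memLp v.fst).integrable one_le_two

theorem slope_eq_add_integral (v : EnergySpace) {x : ℝ} (hx : x ∈ Icc (0 : ℝ) 1) :
    slope v x = v.snd.snd + ∫ t in (0 : ℝ)..x, v.fst t := by
  rw [slope, L2.inner_indicatorConstLp_one, Measure.restrict_restrict measurableSet_Iic,
    intervalIntegral.integral_of_le hx.1, inter_comm, Ioc_inter_Iic, min_eq_right hx.2]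

theorem abs_slope_sub_le (v : EnergySpace) (x : ℝ) : |slope v x - v.snd.snd| ≤ ‖v.fst‖ := by
  rw [slope, add_sub_cancel_left]
  refine (abs_real_inner_le_norm _ _).trans (mul_le_of_le_one_left (norm_nonneg _) ?_)
  refine (norm_indicatorConstLp_le).trans ?_
  rw [norm_one, one_mul]
  exact Real.rpow_le_one measureReal_nonneg measureReal_le_one (by norm_num)

theorem abs_slope_le (v : EnergySpace) (x : ℝ) : |slope v x| ≤ |v.snd.snd| + ‖v.fst‖ := by
  have h1 := abs_slope_sub_le v x
  have h2 := abs_sub_abs_le_abs_sub (slope v x) v.snd.snd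
  linarith

theorem slope_zero (v : EnergySpace) : slope v 0 = v.snd.snd := by
  simp [slope_eq_add_integral v (x := 0) (by simp)]

theorem value_zero (v : EnergySpace) : value v 0 = v.snd.fst := by
  simp [value]

theorem continuousOn_slope (v : EnergySpace) : ContinuousOn (slope v) (Icc 0 1) := by
  refine ContinuousOn.congr (f := fun x => v.snd.snd + ∫ t in (0 : ℝ)..x, v.fst t) ?_
    fun x hx => slope_eq_add_integral v hx
  refine continuousOn_const.add ?_
  have := intervalIntegral.continuousOn_primitive_interval (a := 0) (b := 1) (μ := volume)
    (f := v.fst) ?_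
  · rwa [uIcc_of_le zero_le_one] at this
  · rw [uIcc_of_le zero_le_one, integrableOn_Icc_iff_integrableOn_Ioc]
    exact (Lp.memLp v.fst).integrable one_le_two

theorem intervalIntegrable_slope (v : EnergySpace) {x y : ℝ} (hx : x ∈ Icc (0 : ℝ) 1)
    (hy : y ∈ Icc (0 : ℝ) 1) : IntervalIntegrable (slope v) volume x y :=
  ((continuousOn_slope v).mono (ordConnected_Icc.uIcc_subset hx hy)).intervalIntegrable

theorem hasDerivWithinAt_value (v : EnergySpace) {x : ℝ} (hx : x ∈ Icc (0 : ℝ) 1) :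
    HasDerivWithinAt (value v) (slope v x) (Icc 0 1) x :=
  hasDerivWithinAt_add_integral (continuousOn_slope v) _ hx

theorem continuousOn_value (v : EnergySpace) : ContinuousOn (value v) (Icc 0 1) :=
  fun _ hx => (hasDerivWithinAt_value v hx).continuousWithinAt

theorem value_sub (v : EnergySpace) {x y : ℝ} (hx : x ∈ Icc (0 : ℝ) 1) (hy : y ∈ Icc (0 : ℝ) 1) :
    value v y - value v x = ∫ t in x..y, slope v t := by
  have h0 : (0 : ℝ) ∈ Icc (0 : ℝ) 1 := by simp
  rw [value, value, add_sub_add_left_eq_sub, intervalIntegral.integral_interval_sub_left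
    (intervalIntegrable_slope v h0 hy) (intervalIntegrable_slope v h0 hx)]

theorem abs_value_sub_le (v : EnergySpace) {x y : ℝ} (hx : x ∈ Icc (0 : ℝ) 1)
    (hy : y ∈ Icc (0 : ℝ) 1) :
    |value v y - value v x| ≤ (|v.snd.snd| + ‖v.fst‖) * |y - x| := by
  rw [value_sub v hx hy, ← Real.norm_eq_abs]
  exact intervalIntegral.norm_integral_le_of_norm_le_const fun t _ => abs_slope_le v t

theorem abs_value_sub_affine_le (v : EnergySpace) {x : ℝ} (hx : x ∈ Icc (0 : ℝ) 1) :
    |value v x - (v.snd.fst + v.snd.snd * x)| ≤ ‖v.fst‖ := by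
  have h0 : (0 : ℝ) ∈ Icc (0 : ℝ) 1 := by simp
  have h : value v x - (v.snd.fst + v.snd.snd * x)
      = ∫ t in (0 : ℝ)..x, (slope v t - v.snd.snd) := by
    rw [intervalIntegral.integral_sub (intervalIntegrable_slope v h0 hx) (by simp),
      ← value_sub v h0 hx, value_zero, intervalIntegral.integral_const, smul_eq_mul]
    ring
  rw [h, ← Real.norm_eq_abs]
  refine (intervalIntegral.norm_integral_le_of_norm_le_const
    fun t _ => abs_slope_sub_le v t).trans ?_
  rw [sub_zero, abs_of_nonneg hx.1]
  exact mul_le_of_le_one_right (norm_nonneg _) hx.2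

theorem slope_add (u v : EnergySpace) (x : ℝ) : slope (u + v) x = slope u x + slope v x := by
  simp only [slope, WithLp.add_fst, WithLp.add_snd, inner_add_right]
  ring

theorem slope_smul (c : ℝ) (v : EnergySpace) (x : ℝ) : slope (c • v) x = c * slope v x := by
  simp only [slope, WithLp.smul_fst, WithLp.smul_snd, inner_smul_right, smul_eq_mul]
  ring

theorem value_add (u v : EnergySpace) {x : ℝ} (hx : x ∈ Icc (0 : ℝ) 1) :
    value (u + v) x = value u x + value v x := by
  have h0 : (0 : ℝ) ∈ Icc (0 : ℝ) 1 := by simp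
  simp only [value, slope_add, WithLp.add_fst, WithLp.add_snd]
  rw [intervalIntegral.integral_add (intervalIntegrable_slope u h0 hx)
    (intervalIntegrable_slope v h0 hx)]
  ring

theorem value_smul (c : ℝ) (v : EnergySpace) (x : ℝ) : value (c • v) x = c * value v x := by
  simp only [value, slope_smul, WithLp.smul_fst, WithLp.smul_snd, smul_eq_mul,
    intervalIntegral.integral_const_mul]
  ring

theorem slope_mk_zero (p q x : ℝ) : slope (mk 0 p q) x = q := by
  simp [slope, mk]

theorem value_mk_zero (p q x : ℝ) : value (mk 0 p q) x = p + q * x := by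
  simp only [value, slope_mk_zero, intervalIntegral.integral_const, sub_zero, smul_eq_mul]
  rw [mul_comm]
  rfl

/-- The derivative at a point as a bounded functional. -/
noncomputable def slopeCLM (x : ℝ) : EnergySpace →L[ℝ] ℝ :=
  LinearMap.mkContinuous
    { toFun := fun v => slope v x
      map_add' := fun u v => slope_add u v x
      map_smul' := fun c v => slope_smul c v x } 2 fun v => by
    have := abs_slope_le v x
    have := abs_snd_snd_le v
    have := norm_fst_le v
    simp only [LinearMap.coe_mk, AddHom.coe_mk, Real.norm_eq_abs]
    linarith

@[simp]
theorem slopeCLM_apply (x : ℝ) (v : EnergySpace) : slopeCLM x v = slope v x := rfl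

theorem abs_value_le (v : EnergySpace) {x : ℝ} (hx : x ∈ Icc (0 : ℝ) 1) :
    |value v x| ≤ 3 * ‖v‖ := by
  have h1 := abs_value_sub_le v (x := 0) (by simp) hx
  have h2 := abs_snd_snd_le v
  have h3 := norm_fst_le v
  have h4 := abs_snd_fst_le v
  rw [value_zero, sub_zero, abs_of_nonneg hx.1] at h1
  have h5 := abs_sub_abs_le_abs_sub (value v x) v.snd.fst
  have h6 : (|v.snd.snd| + ‖v.fst‖) * x ≤ |v.snd.snd| + ‖v.fst‖ :=
    mul_le_of_le_one_right (by positivity) hx.2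
  linarith

/-- The embedding of the energy space into the continuous functions. -/
noncomputable def valueCLM : EnergySpace →L[ℝ] C(I, ℝ) :=
  LinearMap.mkContinuous
    { toFun := fun v =>
        ⟨fun x => value v x, continuousOn_iff_continuous_domRestrict.1 (continuousOn_value v)⟩
      map_add' := fun u v => ContinuousMap.ext fun x => value_add u v x.2
      map_smul' := fun c v => ContinuousMap.ext fun x => value_smul c v x } 3 fun v => by
    rw [ContinuousMap.norm_le _ (by positivity)]
    exact fun x => abs_value_le v x.2

@[simp]
theorem valueCLM_apply (v : EnergySpace) (x : I) : valueCLM v x = value v x := rfl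

theorem isCompactOperator_valueCLM : IsCompactOperator valueCLM := by
  let e := ContinuousMap.linearIsometryBoundedOfCompact I ℝ ℝ
  let T : EnergySpace →L[ℝ] BoundedContinuousFunction I ℝ :=
    (e : C(I, ℝ) →L[ℝ] BoundedContinuousFunction I ℝ) ∘L valueCLM
  have hT : IsCompactOperator T := by
    refine (isCompactOperator_iff_isCompact_closure_image_ball T.toLinearMap
      zero_lt_one).2 ?_
    refine BoundedContinuousFunction.arzela_ascoli (Icc (-3) 3) isCompact_Icc _ ?_ ?_
    · rintro _ x ⟨v, hv, rfl⟩
      refine abs_le.1 ?_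
      refine (abs_value_le v x.2).trans ?_
      have := mem_ball_zero_iff.1 hv
      linarith
    · refine Metric.equicontinuous_of_continuity_modulus (fun t => 2 * t) ?_ _ ?_
      · exact (continuous_const_mul (2 : ℝ)).tendsto' 0 0 (mul_zero 2)
      · rintro x y ⟨_, v, hv, rfl⟩
        rw [dist_comm x y, dist_comm, Real.dist_eq]
        refine (abs_value_sub_le v x.2 y.2).trans ?_
        have h1 := mem_ball_zero_iff.1 hv
        have h2 := abs_snd_snd_le v
        have h3 := norm_fst_le v
        exact mul_le_mul_of_nonneg_right (by linarith) (abs_nonneg _)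
  exact hT.clm_comp (e.symm : BoundedContinuousFunction I ℝ →L[ℝ] C(I, ℝ))

end EnergySpace

end EnergySpace

section EnergyForm

open MeasureTheory unitInterval
open scoped InnerProductSpace

namespace EnergySpace

/-- The value `β y'(0) - α y(0)` prescribed for `y''(0)`. -/
noncomputable def leftMoment (α β : ℝ) : EnergySpace →L[ℝ] ℝ :=
  β • slopeCLM 0 - α • (ContinuousMap.evalCLM ℝ (0 : I) ∘L valueCLM)

/-- The value `α y(1) + β y'(1)` prescribed for `-y''(1)`. -/
noncomputable def rightMoment (α β : ℝ) : EnergySpace →L[ℝ] ℝ :=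
  α • (ContinuousMap.evalCLM ℝ (1 : I) ∘L valueCLM) + β • slopeCLM 1

theorem leftMoment_apply (α β : ℝ) (v : EnergySpace) :
    leftMoment α β v = β * v.snd.snd - α * v.snd.fst := by
  simp [leftMoment, slope_zero, value_zero]

theorem rightMoment_apply (α β : ℝ) (v : EnergySpace) :
    rightMoment α β v = α * value v 1 + β * slope v 1 := by
  simp [rightMoment]

/-- The embedding of the energy space into `L²(m)`. -/
noncomputable def toL2 (m : Measure I) [IsFiniteMeasure m] : EnergySpace →L[ℝ] Lp ℝ 2 m :=
  ContinuousMap.toLp 2 m ℝ ∘L valueCLM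

theorem inner_toL2 (m : Measure I) [IsFiniteMeasure m] (u v : EnergySpace) :
    ⟪toL2 m u, toL2 m v⟫_ℝ = ∫ x : I, value u x * value v x ∂m := by
  rw [toL2, ContinuousLinearMap.comp_apply, ContinuousLinearMap.comp_apply,
    ContinuousMap.inner_toLp]
  simp [mul_comm]

theorem isCompactOperator_toL2 (m : Measure I) [IsFiniteMeasure m] :
    IsCompactOperator (toL2 m) :=
  isCompactOperator_valueCLM.clm_comp (ContinuousMap.toLp 2 m ℝ)

/-- The operator representing the quadratic form of the boundary value problem, shifted by the
`L²(m)` inner product. -/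
noncomputable def energyOperator (α β : ℝ) (m : Measure I) [IsFiniteMeasure m] :
    EnergySpace →L[ℝ] EnergySpace :=
  (WithLp.fstL 2 ℝ _ _).adjoint ∘L (WithLp.fstL 2 ℝ _ _)
    + β⁻¹ • ((leftMoment α β).adjoint ∘L leftMoment α β)
    + β⁻¹ • ((rightMoment α β).adjoint ∘L rightMoment α β)
    + (toL2 m).adjoint ∘L toL2 m

theorem inner_energyOperator (α β : ℝ) (m : Measure I) [IsFiniteMeasure m] (u v : EnergySpace) :
    ⟪energyOperator α β m u, v⟫_ℝ = ⟪u.fst, v.fst⟫_ℝ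
      + β⁻¹ * (leftMoment α β u * leftMoment α β v)
      + β⁻¹ * (rightMoment α β u * rightMoment α β v) + ⟪toL2 m u, toL2 m v⟫_ℝ := by
  simp [energyOperator, inner_add_left, inner_smul_left, ContinuousLinearMap.adjoint_inner_left,
    mul_comm]

theorem energyOperator_symm (α β : ℝ) (m : Measure I) [IsFiniteMeasure m] (u v : EnergySpace) :
    ⟪energyOperator α β m u, v⟫_ℝ = ⟪energyOperator α β m v, u⟫_ℝ := by
  rw [inner_energyOperator, inner_energyOperator, real_inner_comm, real_inner_comm (toL2 m v)]
  ring

theorem abs_snd_snd_le_moments {α β : ℝ} (hα : 0 ≤ α) (hβ : 0 < β) (v : EnergySpace) :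
    |v.snd.snd| ≤ β⁻¹ * (|leftMoment α β v| + |rightMoment α β v|) + ‖v.fst‖ := by
  have h1 := abs_le.1 (abs_value_sub_affine_le v (x := 1) (by simp))
  have h2 := abs_le.1 (abs_slope_sub_le v 1)
  have e0 := leftMoment_apply α β v
  have e1 := rightMoment_apply α β v
  have a0 := neg_abs_le (leftMoment α β v)
  have a1 := neg_abs_le (rightMoment α β v)
  have b0 := le_abs_self (leftMoment α β v)
  have b1 := le_abs_self (rightMoment α β v)
  set s := |leftMoment α β v| + |rightMoment α β v| with hs
  have hs0 : 0 ≤ s := by positivity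
  have hβs : β * (β⁻¹ * s) = s := by field_simp
  have ht : 0 ≤ β⁻¹ * s := by positivity
  have hn := norm_nonneg v.fst
  have key : |v.snd.snd| * (α + 2 * β) ≤ (β⁻¹ * s + ‖v.fst‖) * (α + 2 * β) := by
    rw [← abs_of_pos (show 0 < α + 2 * β by linarith), ← abs_mul,
      abs_of_pos (show 0 < α + 2 * β by linarith), abs_le]
    constructor <;> nlinarith [mul_nonneg hα ht, mul_le_mul_of_nonneg_left h1.1 hα,
      mul_le_mul_of_nonneg_left h1.2 hα, mul_le_mul_of_nonneg_left h2.1 hβ.le,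
      mul_le_mul_of_nonneg_left h2.2 hβ.le, mul_nonneg hβ.le hn]
  exact le_of_mul_le_mul_right key (by linarith)

theorem sq_snd_fst_le (m : Measure I) [IsProbabilityMeasure m] (v : EnergySpace) :
    v.snd.fst ^ 2 ≤ 3 * (‖toL2 m v‖ ^ 2 + v.snd.snd ^ 2 + ‖v.fst‖ ^ 2) := by
  have hpt : ∀ x : I, v.snd.fst ^ 2
      ≤ 3 * (value v x * value v x) + 3 * (v.snd.snd ^ 2 + ‖v.fst‖ ^ 2) := fun x => by
    have h1 := sq_le_sq' (abs_le.1 (abs_value_sub_affine_le v x.2)).1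
      (abs_le.1 (abs_value_sub_affine_le v x.2)).2
    have h2 : (v.snd.snd * x) ^ 2 ≤ v.snd.snd ^ 2 := by
      rw [mul_pow]
      exact mul_le_of_le_one_right (sq_nonneg _) (pow_le_one₀ x.2.1 x.2.2)
    nlinarith [sq_nonneg (value v x + v.snd.snd * x), sq_nonneg (value v x
      + (value v x - (v.snd.fst + v.snd.snd * x))), sq_nonneg (v.snd.snd * x
      - (value v x - (v.snd.fst + v.snd.snd * x)))]
  have hi : Integrable (fun x : I => value v x * value v x) m :=
    ((valueCLM v).continuous.mul (valueCLM v).continuous).integrable_of_hasCompactSupport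
      (HasCompactSupport.of_compactSpace _)
  have h := integral_mono (μ := m) (integrable_const _) ((hi.const_mul 3).add (integrable_const _))
    hpt
  rw [integral_add' (hi.const_mul 3) (integrable_const _), integral_const_mul, integral_const,
    integral_const, ← inner_toL2, real_inner_self_eq_norm_sq] at h
  simp only [probReal_univ, one_smul] at h
  linarith

theorem exists_coercive {α β : ℝ} (hα : 0 ≤ α) (hβ : 0 < β) (m : Measure I)
    [IsProbabilityMeasure m] :
    ∃ c > 0, ∀ v, c * ‖v‖ ^ 2 ≤ ⟪energyOperator α β m v, v⟫_ℝ := by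
  have hb : 0 < β⁻¹ := inv_pos.2 hβ
  refine ⟨(16 * (1 + β⁻¹))⁻¹, by positivity, fun v => ?_⟩
  rw [inv_mul_le_iff₀ (by positivity), inner_energyOperator, real_inner_self_eq_norm_sq,
    real_inner_self_eq_norm_sq, norm_sq_def]
  have h1 := abs_snd_snd_le_moments hα hβ v
  have h2 := sq_snd_fst_le m v
  have h3 : v.snd.snd ^ 2
      ≤ 4 * β⁻¹ * (β⁻¹ * leftMoment α β v ^ 2 + β⁻¹ * rightMoment α β v ^ 2) + 2 * ‖v.fst‖ ^ 2 := by
    have h4 : |v.snd.snd| ^ 2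
        ≤ (β⁻¹ * (|leftMoment α β v| + |rightMoment α β v|) + ‖v.fst‖) ^ 2 :=
      pow_le_pow_left₀ (abs_nonneg _) h1 2
    rw [sq_abs] at h4
    rw [← sq_abs (leftMoment α β v), ← sq_abs (rightMoment α β v)]
    linarith [sq_nonneg (β⁻¹ * (|leftMoment α β v| + |rightMoment α β v|) - ‖v.fst‖),
      sq_nonneg (β⁻¹ * (|leftMoment α β v| - |rightMoment α β v|))]
  have hl : 0 ≤ β⁻¹ * leftMoment α β v ^ 2 := by positivity
  have hr : 0 ≤ β⁻¹ * rightMoment α β v ^ 2 := by positivity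
  have ht := sq_nonneg ‖toL2 m v‖
  have hw := sq_nonneg ‖v.fst‖
  nlinarith [mul_nonneg hb.le hl, mul_nonneg hb.le hr, mul_nonneg hb.le ht, mul_nonneg hb.le hw]

theorem memLp_unitVolume {f : ℝ → ℝ} (hf : ContinuousOn f (Icc 0 1)) : MemLp f 2 unitVolume :=
  (memLp_two_iff_integrable_sq
    ((hf.mono Ioc_subset_Icc_self).aestronglyMeasurable measurableSet_Ioc)).2
    ((hf.pow 2).integrableOn_Icc.mono_set Ioc_subset_Icc_self)

theorem slope_eq_add_integral_of_ae_eq (v : EnergySpace) {f : ℝ → ℝ} (hf : v.fst =ᵐ[unitVolume] f)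
    {x : ℝ} (hx : x ∈ Icc (0 : ℝ) 1) : slope v x = v.snd.snd + ∫ t in (0 : ℝ)..x, f t := by
  rw [slope_eq_add_integral _ hx]
  refine congrArg (v.snd.snd + ·) (intervalIntegral.integral_congr_ae_restrict ?_)
  rw [uIoc_of_le hx.1]
  exact ae_restrict_of_ae_restrict_of_subset (Ioc_subset_Ioc_right hx.2) hf

theorem inner_eq_integral_of_ae_eq {w z : Lp ℝ 2 unitVolume} {f : ℝ → ℝ}
    (hf : w =ᵐ[unitVolume] f) : ⟪w, z⟫_ℝ = ∫ x in (0 : ℝ)..1, f x * z x := by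
  rw [L2.inner_def, intervalIntegral.integral_of_le zero_le_one]
  refine integral_congr_ae ?_
  filter_upwards [hf] with x hx
  simp [hx, mul_comm]

theorem exists_value_eq {y y₁ y₂ : ℝ → ℝ}
    (hy : ∀ x ∈ Icc (0 : ℝ) 1, HasDerivWithinAt y (y₁ x) (Icc 0 1) x)
    (hy₁ : ∀ x ∈ Icc (0 : ℝ) 1, HasDerivWithinAt y₁ (y₂ x) (Icc 0 1) x)
    (hy₂ : ContinuousOn y₂ (Icc 0 1)) :
    ∃ u : EnergySpace, u.fst =ᵐ[unitVolume] y₂ ∧ (∀ x ∈ Icc (0 : ℝ) 1, slope u x = y₁ x) ∧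
      ∀ x ∈ Icc (0 : ℝ) 1, value u x = y x := by
  have hmem := memLp_unitVolume hy₂
  have hw : hmem.toLp y₂ =ᵐ[unitVolume] y₂ := hmem.coeFn_toLp
  have hs : ∀ x ∈ Icc (0 : ℝ) 1, slope (mk (hmem.toLp y₂) (y 0) (y₁ 0)) x = y₁ x := fun x hx => by
    rw [eq_add_integral_of_hasDerivWithinAt hy₁ hy₂ hx]
    exact slope_eq_add_integral_of_ae_eq (mk (hmem.toLp y₂) (y 0) (y₁ 0)) hw hx
  refine ⟨mk (hmem.toLp y₂) (y 0) (y₁ 0), hw, hs, fun x hx => ?_⟩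
  rw [value, eq_add_integral_of_hasDerivWithinAt hy
    (fun t ht => (hy₁ t ht).continuousWithinAt) hx]
  refine congrArg (y 0 + ·) (intervalIntegral.integral_congr fun t ht => hs t ?_)
  rw [uIcc_of_le hx.1] at ht
  exact Icc_subset_Icc_right hx.2 ht

theorem not_finiteDimensional_range_toL2 (m : Measure I) [IsProbabilityMeasure m]
    [NullSingletonClass m] : ¬ FiniteDimensional ℝ (toL2 m).range := by
  intro hfin
  let Φ : Polynomial ℝ →ₗ[ℝ] Lp ℝ 2 m :=
    (ContinuousMap.toLp 2 m ℝ).toLinearMap ∘ₗ (Polynomial.toContinuousMapOnAlgHom I).toLinearMap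
  have hΦ : ∀ g, Φ g = ContinuousMap.toLp 2 m ℝ (g.toContinuousMapOn I) := fun g => rfl
  have hrange : ∀ g, Φ g ∈ (toL2 m).range := fun g => by
    obtain ⟨u, -, -, hu⟩ := exists_value_eq (y := fun x => g.eval x)
      (y₁ := fun x => g.derivative.eval x) (y₂ := fun x => g.derivative.derivative.eval x)
      (fun x _ => (g.hasDerivAt x).hasDerivWithinAt)
      (fun x _ => (g.derivative.hasDerivAt x).hasDerivWithinAt)
      g.derivative.derivative.continuous.continuousOn
    refine ⟨u, ?_⟩
    rw [hΦ]
    have h : valueCLM u = g.toContinuousMapOn I := ContinuousMap.ext fun x => hu x x.2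
    exact congrArg (ContinuousMap.toLp 2 m ℝ) h
  have hinj : Function.Injective (Φ.codRestrict _ hrange) := by
    rw [← LinearMap.ker_eq_bot, LinearMap.ker_codRestrict, LinearMap.ker_eq_bot']
    intro g hg
    by_contra hg0
    have h1 : ∀ᵐ x : I ∂m, g.eval (x : ℝ) = 0 := by
      filter_upwards [ContinuousMap.coeFn_toLp (𝕜 := ℝ) (p := 2) m (g.toContinuousMapOn I),
        Lp.coeFn_zero ℝ 2 m] with x hx hx0
      rw [← hΦ, hg, hx0] at hx
      exact hx.symm
    have h2 : ((↑) ⁻¹' (g.rootSet ℝ) : Set I).Finite :=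
      (g.rootSet_finite ℝ).preimage Subtype.val_injective.injOn
    have h3 : ∀ᵐ x : I ∂m, x ∉ ((↑) ⁻¹' (g.rootSet ℝ) : Set I) :=
      measure_eq_zero_iff_ae_notMem.1 (h2.measure_zero m)
    obtain ⟨x, hx, hx'⟩ := (h1.and h3).exists
    exact hx' (by simp [Polynomial.mem_rootSet, hg0, hx])
  exact Polynomial.not_finite (R := ℝ) (Module.Finite.of_injective _ hinj)

end EnergySpace

end EnergyForm

section Jets

theorem Y2_eq (y : ℝ → ℝ) : Y2 y = derivWithin (Y1 y) (Icc 0 1) := by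
  rw [Y1, ← iteratedDerivWithin_one (f := y), ← iteratedDerivWithin_succ]
  rfl

theorem Y3_eq (y : ℝ → ℝ) : Y3 y = derivWithin (Y2 y) (Icc 0 1) := by
  rw [Y2, ← iteratedDerivWithin_succ]
  rfl

theorem contDiffOn_three_of_hasDerivWithinAt {y y₁ y₂ y₃ : ℝ → ℝ}
    (h₁ : ∀ x ∈ Icc (0 : ℝ) 1, HasDerivWithinAt y (y₁ x) (Icc 0 1) x)
    (h₂ : ∀ x ∈ Icc (0 : ℝ) 1, HasDerivWithinAt y₁ (y₂ x) (Icc 0 1) x)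
    (h₃ : ∀ x ∈ Icc (0 : ℝ) 1, HasDerivWithinAt y₂ (y₃ x) (Icc 0 1) x)
    (hc : ContinuousOn y₃ (Icc 0 1)) :
    ContDiffOn ℝ 3 y (Icc 0 1) ∧ EqOn (Y1 y) y₁ (Icc 0 1) ∧ EqOn (Y2 y) y₂ (Icc 0 1) ∧
      EqOn (Y3 y) y₃ (Icc 0 1) := by
  have hs : UniqueDiffOn ℝ (Icc (0 : ℝ) 1) := uniqueDiffOn_Icc zero_lt_one
  have e₁ : EqOn (Y1 y) y₁ (Icc 0 1) := fun x hx => (h₁ x hx).derivWithin (hs x hx)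
  have e₂ : EqOn (Y2 y) y₂ (Icc 0 1) := fun x hx => by
    rw [Y2_eq]
    exact ((h₂ x hx).congr e₁ (e₁ hx)).derivWithin (hs x hx)
  have e₃ : EqOn (Y3 y) y₃ (Icc 0 1) := fun x hx => by
    rw [Y3_eq]
    exact ((h₃ x hx).congr e₂ (e₂ hx)).derivWithin (hs x hx)
  have hy₁ : ContDiffOn ℝ 2 y₁ (Icc 0 1) := by
    rw [show (2 : WithTop ℕ∞) = 1 + 1 from rfl, contDiffOn_succ_iff_derivWithin hs]
    refine ⟨fun x hx => (h₂ x hx).differentiableWithinAt, by simp, ?_⟩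
    exact (contDiffOn_one_of_hasDerivWithinAt hs h₃ hc).congr
      fun x hx => (h₂ x hx).derivWithin (hs x hx)
  refine ⟨?_, e₁, e₂, e₃⟩
  rw [show (3 : WithTop ℕ∞) = 2 + 1 from rfl, contDiffOn_succ_iff_derivWithin hs]
  exact ⟨fun x hx => (h₁ x hx).differentiableWithinAt, by simp, hy₁.congr e₁⟩

theorem ContDiffOn.hasDerivWithinAt_Y1_Y2_Y3 {y : ℝ → ℝ} (hy : ContDiffOn ℝ 3 y (Icc 0 1)) :
    (∀ x ∈ Icc (0 : ℝ) 1, HasDerivWithinAt y (Y1 y x) (Icc 0 1) x) ∧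
    (∀ x ∈ Icc (0 : ℝ) 1, HasDerivWithinAt (Y1 y) (Y2 y x) (Icc 0 1) x) ∧
    (∀ x ∈ Icc (0 : ℝ) 1, HasDerivWithinAt (Y2 y) (Y3 y x) (Icc 0 1) x) ∧
    ContinuousOn (Y3 y) (Icc 0 1) := by
  have hs : UniqueDiffOn ℝ (Icc (0 : ℝ) 1) := uniqueDiffOn_Icc zero_lt_one
  have d₁ := hy.differentiableOn_iteratedDerivWithin (m := 1) (by norm_num) hs
  rw [iteratedDerivWithin_one] at d₁
  have d₂ := hy.differentiableOn_iteratedDerivWithin (m := 2) (by norm_num) hs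
  refine ⟨fun x hx => (hy.differentiableOn (by norm_num) x hx).hasDerivWithinAt,
    fun x hx => ?_, fun x hx => ?_, hy.continuousOn_iteratedDerivWithin (m := 3) le_rfl hs⟩
  · rw [Y2_eq]
    exact (d₁ x hx).hasDerivWithinAt
  · rw [Y3_eq]
    exact (d₂ x hx).hasDerivWithinAt

end Jets

section WeakFormulation

open MeasureTheory unitInterval EnergySpace
open scoped InnerProductSpace

/-- Green's formula for solutions of `(m₃ - λ P y)' = -λ P y'`, where `m₂' = m₃`. -/
theorem integral_moment_mul {P : ℝ → ℝ} {m : Measure I} (hPc : ContinuousOn P (Icc 0 1))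
    (hP0 : P 0 = 0) (hP1 : P 1 = 1)
    (hm : ∀ g g' : ℝ → ℝ, (∀ x ∈ Icc (0 : ℝ) 1, HasDerivWithinAt g (g' x) (Icc 0 1) x) →
      ContinuousOn g' (Icc 0 1) → ∫ x : I, g x ∂m = g 1 - ∫ x in (0 : ℝ)..1, P x * g' x)
    {lam : ℝ} {y y₁ m₂ m₃ : ℝ → ℝ}
    (hy : ∀ x ∈ Icc (0 : ℝ) 1, HasDerivWithinAt y (y₁ x) (Icc 0 1) x)
    (hy₁ : ContinuousOn y₁ (Icc 0 1))
    (hm₂ : ∀ x ∈ Icc (0 : ℝ) 1, HasDerivWithinAt m₂ (m₃ x) (Icc 0 1) x)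
    (hm₃ : ∀ x ∈ Icc (0 : ℝ) 1,
      HasDerivWithinAt (fun t => m₃ t - lam * P t * y t) (-(lam * P x * y₁ x)) (Icc 0 1) x)
    (z : EnergySpace) :
    ∫ x in (0 : ℝ)..1, m₂ x * z.fst x
      = m₂ 1 * slope z 1 - m₂ 0 * slope z 0 - m₃ 1 * value z 1 + m₃ 0 * value z 0
        + lam * ∫ x : I, y x * value z x ∂m := by
  have hyc : ContinuousOn y (Icc 0 1) := fun x hx => (hy x hx).continuousWithinAt
  have hNc : ContinuousOn (fun t => m₃ t - lam * P t * y t) (Icc 0 1) :=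
    fun x hx => (hm₃ x hx).continuousWithinAt
  have hm₃c : ContinuousOn m₃ (Icc 0 1) :=
    (hNc.add ((hPc.const_mul lam).mul hyc)).congr fun x _ => by simp
  have hDc := continuousOn_slope z
  have hYc := continuousOn_value z
  have h1 := integral_mul_eq_sub_of_primitive hm₂ hm₃c (intervalIntegrable_fst z)
    fun x hx => slope_eq_add_integral z hx
  have c1 : ContinuousOn (fun x => -(lam * P x * y₁ x) * value z x
      + (m₃ x - lam * P x * y x) * slope z x) (Icc 0 1) := by fun_prop
  have c2 : ContinuousOn (fun x => y₁ x * value z x + y x * slope z x) (Icc 0 1) := by fun_prop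
  have h2 := eq_add_integral_of_hasDerivWithinAt
    (fun x hx => (hm₃ x hx).mul (hasDerivWithinAt_value z hx)) c1 (x := 1) (by simp)
  have h3 := hm (fun x => y x * value z x) _
    (fun x hx => (hy x hx).mul (hasDerivWithinAt_value z hx)) c2
  have h4 : ∫ x in (0 : ℝ)..1, m₃ x * slope z x
      = (∫ x in (0 : ℝ)..1, (-(lam * P x * y₁ x) * value z x
          + (m₃ x - lam * P x * y x) * slope z x))
        + lam * ∫ x in (0 : ℝ)..1, P x * (y₁ x * value z x + y x * slope z x) := by
    rw [← intervalIntegral.integral_const_mul, ← intervalIntegral.integral_add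
      (c1.intervalIntegrable_of_Icc zero_le_one)
      (((hPc.fun_mul c2).intervalIntegrable_of_Icc zero_le_one).const_mul lam)]
    refine intervalIntegral.integral_congr fun x _ => ?_
    ring
  simp only [Pi.mul_apply, hP0, hP1] at h2
  rw [h1, h4, h3]
  linear_combination h2

theorem add_one_mem_pencilEigenvalues_iff {α β : ℝ} {m : Measure I} [IsFiniteMeasure m] {lam : ℝ} :
    lam + 1 ∈ GeneralizedEigenvalue.pencilEigenvalues (energyOperator α β m) (toL2 m) ↔
      ∃ u : EnergySpace, u ≠ 0 ∧ ∀ z : EnergySpace, ⟪u.fst, z.fst⟫_ℝ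
        + β⁻¹ * (leftMoment α β u * leftMoment α β z)
        + β⁻¹ * (rightMoment α β u * rightMoment α β z)
          = lam * ∫ x : I, value u x * value z x ∂m := by
  refine exists_congr fun u => and_congr_right fun _ => forall_congr' fun z => ?_
  rw [inner_energyOperator, ← inner_toL2, add_mul, one_mul, add_left_inj]

theorem IsEigenvalue.add_one_mem_pencilEigenvalues {P : ℝ → ℝ} {m : Measure I} [IsFiniteMeasure m]
    (hPc : ContinuousOn P (Icc 0 1)) (hP0 : P 0 = 0) (hP1 : P 1 = 1)
    (hm : ∀ g g' : ℝ → ℝ, (∀ x ∈ Icc (0 : ℝ) 1, HasDerivWithinAt g (g' x) (Icc 0 1) x) →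
      ContinuousOn g' (Icc 0 1) → ∫ x : I, g x ∂m = g 1 - ∫ x in (0 : ℝ)..1, P x * g' x)
    {α β lam : ℝ} (hβ : 0 < β) (h : IsEigenvalue P α β lam) :
    lam + 1 ∈ GeneralizedEigenvalue.pencilEigenvalues (energyOperator α β m) (toL2 m) := by
  obtain ⟨y, ⟨x₀, hx₀, hyx₀⟩, ⟨hy, hode⟩, b₁, b₂, b₃, b₄⟩ := h
  obtain ⟨d₁, d₂, d₃, -⟩ := hy.hasDerivWithinAt_Y1_Y2_Y3
  have h0 : (0 : ℝ) ∈ Icc (0 : ℝ) 1 := by simp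
  have h1 : (1 : ℝ) ∈ Icc (0 : ℝ) 1 := by simp
  obtain ⟨u, hu₂, hu₁, hu⟩ := exists_value_eq d₁ d₂ fun x hx => (d₃ x hx).continuousWithinAt
  refine add_one_mem_pencilEigenvalues_iff.2 ⟨u, ?_, fun z => ?_⟩
  · rintro rfl
    refine hyx₀ ?_
    rw [← hu x₀ hx₀]
    simpa using value_smul 0 0 x₀
  · have hint : ∫ x : I, value u x * value z x ∂m = ∫ x : I, y x * value z x ∂m :=
      integral_congr_ae (Eventually.of_forall fun x => by simp only [hu x x.2])
    rw [inner_eq_integral_of_ae_eq hu₂, hint,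
      integral_moment_mul hPc hP0 hP1 hm d₁ (fun x hx => (d₂ x hx).continuousWithinAt) d₃ hode z,
      leftMoment_apply, leftMoment_apply, rightMoment_apply, rightMoment_apply, ← slope_zero u,
      ← value_zero u, hu 0 h0, hu 1 h1, hu₁ 0 h0, hu₁ 1 h1, slope_zero, value_zero]
    have e₀ : Y2 y 0 = β * Y1 y 0 - α * y 0 := by linarith
    have e₁ : Y2 y 1 = -(α * y 1 + β * Y1 y 1) := by linarith
    have e₂ : Y3 y 0 = β⁻¹ * (α * Y2 y 0) := by
      rw [eq_inv_mul_iff_mul_eq₀ hβ.ne']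
      linarith
    have e₃ : Y3 y 1 = -(β⁻¹ * (α * Y2 y 1)) := by
      rw [← mul_neg, eq_inv_mul_iff_mul_eq₀ hβ.ne']
      linarith
    rw [e₂, e₃, e₀, e₁]
    field_simp
    ring

theorem isEigenvalue_of_add_one_mem_pencilEigenvalues {P : ℝ → ℝ} {m : Measure I}
    [IsProbabilityMeasure m] (hPc : ContinuousOn P (Icc 0 1)) (hP0 : P 0 = 0) (hP1 : P 1 = 1)
    (hm : ∀ g g' : ℝ → ℝ, (∀ x ∈ Icc (0 : ℝ) 1, HasDerivWithinAt g (g' x) (Icc 0 1) x) →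
      ContinuousOn g' (Icc 0 1) → ∫ x : I, g x ∂m = g 1 - ∫ x in (0 : ℝ)..1, P x * g' x)
    {α β lam : ℝ} (hα : 0 ≤ α) (hβ : 0 < β)
    (h : lam + 1 ∈ GeneralizedEigenvalue.pencilEigenvalues (energyOperator α β m) (toL2 m)) :
    IsEigenvalue P α β lam := by
  have h0 : (0 : ℝ) ∈ Icc (0 : ℝ) 1 := by simp
  have h1 : (1 : ℝ) ∈ Icc (0 : ℝ) 1 := by simp
  obtain ⟨c, hc, hcoer⟩ := exists_coercive hα hβ m
  obtain ⟨u, hu0, hweak⟩ := add_one_mem_pencilEigenvalues_iff.1 h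
  have hDc := continuousOn_slope u
  have hYc := continuousOn_value u
  let N : ℝ → ℝ := fun x => β⁻¹ * (α * leftMoment α β u)
    + ∫ t in (0 : ℝ)..x, -(lam * P t * slope u t)
  have hN : ∀ x ∈ Icc (0 : ℝ) 1, HasDerivWithinAt N (-(lam * P x * slope u x)) (Icc 0 1) x :=
    fun x hx => hasDerivWithinAt_add_integral (by fun_prop) _ hx
  have hNc : ContinuousOn N (Icc 0 1) := fun x hx => (hN x hx).continuousWithinAt
  let m₃ : ℝ → ℝ := fun x => N x + lam * P x * value u x
  have hm₃c : ContinuousOn m₃ (Icc 0 1) := hNc.add ((hPc.const_mul lam).mul hYc)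
  let m₂ : ℝ → ℝ := fun x => leftMoment α β u + ∫ t in (0 : ℝ)..x, m₃ t
  have hm₂ : ∀ x ∈ Icc (0 : ℝ) 1, HasDerivWithinAt m₂ (m₃ x) (Icc 0 1) x :=
    fun x hx => hasDerivWithinAt_add_integral hm₃c _ hx
  have hm₂c : ContinuousOn m₂ (Icc 0 1) := fun x hx => (hm₂ x hx).continuousWithinAt
  have hN_eq : (fun t => m₃ t - lam * P t * value u t) = N := funext fun t => add_sub_cancel_right _ _
  have hm₂0 : m₂ 0 = leftMoment α β u := by simp [m₂]
  have hm₃0 : m₃ 0 = β⁻¹ * (α * leftMoment α β u) := by simp [m₃, N, hP0]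
  have hmem := memLp_unitVolume hm₂c
  have hf : hmem.toLp m₂ =ᵐ[unitVolume] m₂ := hmem.coeFn_toLp
  have hgreen : ∀ z : EnergySpace, ⟪u.fst - hmem.toLp m₂, z.fst⟫_ℝ
      = (m₃ 1 - β⁻¹ * (α * rightMoment α β u)) * value z 1
        - (m₂ 1 + rightMoment α β u) * slope z 1 := fun z => by
    have hg := integral_moment_mul hPc hP0 hP1 hm (fun x hx => hasDerivWithinAt_value u hx) hDc hm₂
      (by rwa [hN_eq]) z
    have hw := hweak z
    rw [leftMoment_apply α β z, rightMoment_apply α β z] at hw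
    rw [inner_sub_left, inner_eq_integral_of_ae_eq hf, hg, hm₂0, hm₃0, slope_zero, value_zero]
    field_simp at hw ⊢
    linear_combination hw
  have hgreen_affine : ∀ p q : ℝ, (m₃ 1 - β⁻¹ * (α * rightMoment α β u)) * (p + q)
      - (m₂ 1 + rightMoment α β u) * q = 0 := fun p q => by
    have := hgreen (.mk 0 p q)
    rwa [slope_mk_zero, value_mk_zero, mul_one, show (EnergySpace.mk 0 p q).fst = 0 from rfl,
      inner_zero_right, eq_comm] at this
  have hb₃ : m₃ 1 = β⁻¹ * (α * rightMoment α β u) := by linarith [hgreen_affine 1 0]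
  have hb₂ : m₂ 1 = -rightMoment α β u := by linarith [hgreen_affine 1 0, hgreen_affine 0 1]
  have hw : u.fst =ᵐ[unitVolume] m₂ := by
    have huf : u.fst - hmem.toLp m₂ = 0 := by
      rw [← inner_self_eq_zero (𝕜 := ℝ)]
      have := hgreen (.mk (u.fst - hmem.toLp m₂) 0 0)
      rwa [hb₃, hb₂, sub_self, neg_add_cancel, zero_mul, zero_mul, sub_zero] at this
    rwa [sub_eq_zero.1 huf]
  have hslope_deriv : ∀ x ∈ Icc (0 : ℝ) 1, HasDerivWithinAt (slope u) (m₂ x) (Icc 0 1) x :=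
    fun x hx => (hasDerivWithinAt_add_integral hm₂c u.snd.snd hx).congr
      (fun t ht => slope_eq_add_integral_of_ae_eq u hw ht) (slope_eq_add_integral_of_ae_eq u hw hx)
  obtain ⟨hy, e₁, e₂, e₃⟩ := contDiffOn_three_of_hasDerivWithinAt
    (fun x hx => hasDerivWithinAt_value u hx) hslope_deriv hm₂ hm₃c
  refine ⟨value u, ?_, ⟨hy, fun x hx => ?_⟩, ?_⟩
  · by_contra hnt
    simp only [Nontrivial01, not_exists, not_and, not_not] at hnt
    have hJ : toL2 m u = 0 := by
      have hv : valueCLM u = 0 := ContinuousMap.ext fun x => hnt x x.2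
      rw [toL2, ContinuousLinearMap.comp_apply, hv, map_zero]
    have hu := hcoer u
    rw [inner_energyOperator, hweak u, ← inner_toL2, hJ, inner_zero_right, mul_zero, add_zero] at hu
    have : 0 < c * ‖u‖ ^ 2 := by positivity
    linarith
  · rw [e₁ hx]
    have hE : ∀ t ∈ Icc (0 : ℝ) 1, Y3 (value u) t - lam * P t * value u t = N t := fun t ht => by
      rw [e₃ ht]
      exact add_sub_cancel_right _ _
    exact (hN x hx).congr hE (hE x hx)
  · change EqOn (Y1 (value u)) (EnergySpace.slope u) _ at e₁
    rw [BC, e₁ h0, e₁ h1, e₂ h0, e₂ h1, e₃ h0, e₃ h1, hm₂0, hm₃0, hb₂, hb₃, slope_zero, value_zero,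
      leftMoment_apply, rightMoment_apply]
    refine ⟨by ring, ?_, by ring, ?_⟩ <;> field_simp <;> ring

end WeakFormulation

theorem stmt6 (P : ℝ → ℝ) (κ : ℕ) (a : ℝ) (hP : CantorSelfSimilar P κ a)
    (α β : ℝ) (hα : 0 ≤ α) (hβ : 0 < β) :
    {lam : ℝ | IsEigenvalue P α β lam}.Infinite ∧
    ∀ C : ℝ, {lam : ℝ | IsEigenvalue P α β lam ∧ lam ≤ C}.Finite := by
  obtain ⟨hPc, hPm, hP0, hP1, -⟩ := hP
  obtain ⟨m, _, _, hm⟩ := exists_probabilityMeasure_integral_eq hPc hPm hP0 hP1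
  obtain ⟨c, hc, hcoer⟩ := EnergySpace.exists_coercive hα hβ m
  have hsymm := EnergySpace.energyOperator_symm α β m
  have hJ := EnergySpace.isCompactOperator_toL2 m
  have hiff : ∀ lam, IsEigenvalue P α β lam ↔ lam + 1 ∈ GeneralizedEigenvalue.pencilEigenvalues
      (EnergySpace.energyOperator α β m) (EnergySpace.toL2 m) := fun lam =>
    ⟨fun h => h.add_one_mem_pencilEigenvalues hPc hP0 hP1 hm hβ,
      isEigenvalue_of_add_one_mem_pencilEigenvalues hPc hP0 hP1 hm hα hβ⟩
  simp only [hiff]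
  refine ⟨fun hfin => ?_, fun C => ?_⟩
  · refine GeneralizedEigenvalue.infinite_pencilEigenvalues hc hcoer hsymm hJ
      (EnergySpace.not_finiteDimensional_range_toL2 m) ((hfin.image (· + 1)).subset fun s hs => ?_)
    exact ⟨s - 1, by simpa using hs, sub_add_cancel s 1⟩
  · refine ((GeneralizedEigenvalue.finite_pencilEigenvalues_le hc hcoer hsymm hJ (C + 1)).preimage
      (add_left_injective (1 : ℝ)).injOn).subset fun s hs => ⟨hs.1, ?_⟩
    exact add_le_add_left hs.2 1
end

section
/- Let α > 0, β > 0, and let y : [0,1] → ℝ be four times continuously differentiable and satisfy the boundary conditions y″(0) + α·y(0) − β·y′(0) = 0, −β·y‴(0) + α·y″(0) = 0, y″(1) + α·y(1) + β·y′(1) = 0, −β·y‴(1) − α·y″(1) = 0. If y has at least n sign changes on (0,1), then its fourth derivative y⁽⁴⁾ also has at least n sign changes on (0,1). -/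
open Set Filter

/-- `f` has at least `n` sign changes on `(0,1)`. -/
def SignChanges (f : ℝ → ℝ) (n : ℕ) : Prop :=
  ∃ x : Fin (n + 1) → ℝ, StrictMono x ∧ (∀ i, x i ∈ Set.Ioo (0:ℝ) 1) ∧
    ∀ i : Fin n, f (x i.castSucc) * f (x i.succ) < 0

/-- The points `x 0 < ⋯ < x (n - 1)` lie in `S` and `f` alternates in sign along them,
starting with the sign of `ε`. -/
def AlternatesOn (f : ℝ → ℝ) (S : Set ℝ) (ε : ℝ) (x : ℕ → ℝ) (n : ℕ) : Prop :=
  (∀ i < n, x i ∈ S ∧ 0 < ε * (-1) ^ i * f (x i)) ∧ ∀ i, i + 1 < n → x i < x (i + 1)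

namespace AlternatesOn

variable {f : ℝ → ℝ} {S T : Set ℝ} {ε : ℝ} {x : ℕ → ℝ} {n : ℕ}

lemma mono_set (h : AlternatesOn f S ε x n) (hST : S ⊆ T) : AlternatesOn f T ε x n :=
  ⟨fun i hi => ⟨hST (h.1 i hi).1, (h.1 i hi).2⟩, h.2⟩

lemma le_of_le (h : AlternatesOn f S ε x n) {i j : ℕ} (hij : i ≤ j) (hj : j < n) :
    x i ≤ x j := by
  induction j, hij using Nat.le_induction with
  | base => exact le_rfl
  | succ j _ ih => exact (ih (by omega)).trans (h.2 j hj).le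

lemma signChanges (h : AlternatesOn f (Ioo 0 1) ε x (n + 1)) : SignChanges f n := by
  refine ⟨fun i => x i, Fin.strictMono_iff_lt_succ.2 fun i => h.2 i (by omega),
    fun i => (h.1 i i.2).1, fun i => ?_⟩
  have h₁ := (h.1 i (by omega)).2
  have h₂ := (h.1 (i + 1) (by omega)).2
  have hpow : ((-1 : ℝ) ^ (i : ℕ)) ^ 2 = 1 := by rw [← pow_mul, mul_comm, pow_mul]; simp
  have hprod := mul_pos h₁ h₂
  simp only [Fin.val_castSucc, Fin.val_succ]
  have heq : ε * (-1) ^ (i : ℕ) * f (x i) * (ε * (-1) ^ ((i : ℕ) + 1) * f (x (i + 1)))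
      = -(ε ^ 2 * (f (x i) * f (x (i + 1)))) := by
    rw [pow_succ]
    linear_combination (-(ε ^ 2 * (f (x i) * f (x (i + 1))))) * hpow
  rw [heq] at hprod
  exact neg_of_mul_neg_right (neg_pos.1 hprod) (sq_nonneg ε)

/-- Adding a point on either side of an alternating sequence. -/
lemma surround (h : AlternatesOn f S (-ε) x n) {a b : ℝ} (ha : a ∈ S) (hb : b ∈ S)
    (hab : a < b) (hx : ∀ i < n, a < x i ∧ x i < b) (hfa : 0 < ε * f a)
    (hfb : 0 < ε * (-1) ^ (n + 1) * f b) :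
    ∃ r, AlternatesOn f S ε r (n + 2) := by
  refine ⟨fun i => if i = 0 then a else if i ≤ n then x (i - 1) else b, ?_, ?_⟩
  · rintro (_ | i) hi
    · simpa using ⟨ha, hfa⟩
    · by_cases hin : i + 1 ≤ n
      · have := h.1 i (by omega)
        simp only [Nat.succ_ne_zero, if_false, hin, if_true, Nat.add_sub_cancel]
        refine ⟨this.1, ?_⟩
        convert this.2 using 1
        ring
      · obtain rfl : i = n := by omega
        simpa using ⟨hb, hfb⟩
  · rintro (_ | i) hi
    · rcases Nat.eq_zero_or_pos n with rfl | hn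
      · simpa using hab
      · have : 1 ≤ n := hn
        simpa [this] using (hx 0 hn).1
    · by_cases hin : i + 2 ≤ n
      · have h' : i + 1 ≤ n := by omega
        simpa [hin, h'] using h.2 i (by omega)
      · have h' : i + 1 ≤ n := by omega
        simpa [hin, h'] using (hx i (by omega)).2

end AlternatesOn

lemma SignChanges.exists_alternatesOn {f : ℝ → ℝ} {n : ℕ} (hn : 0 < n) (h : SignChanges f n) :
    ∃ ε x, AlternatesOn f (Ioo 0 1) ε x (n + 1) := by
  obtain ⟨x, hmono, hmem, hsign⟩ := h
  have key : ∀ i (hi : i < n + 1), 0 < f (x 0) * (-1) ^ i * f (x ⟨i, hi⟩) := by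
    intro i
    induction i with
    | zero =>
      intro hi
      have h0 : f (x 0) ≠ 0 := by
        have := hsign ⟨0, hn⟩
        exact left_ne_zero_of_mul this.ne
      simpa using mul_self_pos.2 h0
    | succ i ih =>
      intro hi
      have h₁ := ih (by omega)
      have h₂ : f (x ⟨i, by omega⟩) * f (x ⟨i + 1, hi⟩) < 0 := hsign ⟨i, by omega⟩
      have h₃ := mul_pos h₁ (neg_pos.2 h₂)
      have h₄ : 0 < f (x ⟨i, by omega⟩) ^ 2 := by
        have := left_ne_zero_of_mul h₂.ne
        positivity
      refine pos_of_mul_pos_left (b := f (x ⟨i, by omega⟩) ^ 2) ?_ h₄.le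
      convert h₃ using 1
      ring
  refine ⟨f (x 0), fun i => x ⟨min i n, by omega⟩, fun i hi => ⟨hmem _, ?_⟩, fun i hi => ?_⟩
  · have : min i n = i := by omega
    simpa [this] using key i hi
  · exact hmono (Fin.mk_lt_mk.2 (by omega))

section DerivOnIcc

variable {f f' : ℝ → ℝ} {ε : ℝ}

lemma exists_mem_Ioo_deriv_pos
    (hf : ∀ z ∈ Icc (0 : ℝ) 1, HasDerivWithinAt f (f' z) (Icc 0 1) z) {a b : ℝ}
    (ha : 0 ≤ a) (hb : b ≤ 1) (hab : a < b) (h : ε * f a < ε * f b) :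
    ∃ c ∈ Ioo a b, 0 < ε * f' c := by
  have hsub : Icc a b ⊆ Icc 0 1 := Icc_subset_Icc ha hb
  obtain ⟨c, hc, hc'⟩ := exists_hasDerivAt_eq_slope f f' hab
    (fun z hz => (hf z (hsub hz)).continuousWithinAt.mono hsub)
    (fun z hz => (hf z (hsub (Ioo_subset_Icc_self hz))).hasDerivAt
      (Icc_mem_nhds (ha.trans_lt hz.1) (hz.2.trans_le hb)))
  refine ⟨c, hc, ?_⟩
  rw [hc', ← mul_div_assoc]
  exact div_pos (by linarith) (sub_pos.2 hab)

lemma exists_deriv_pos_left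
    (hf : ∀ z ∈ Icc (0 : ℝ) 1, HasDerivWithinAt f (f' z) (Icc 0 1) z) {a : ℝ}
    (ha : a ∈ Icc (0 : ℝ) 1) (h : 0 < ε * f a) :
    (∃ s ∈ Icc 0 a, 0 < ε * f' s) ∨ (0 < ε * f 0 ∧ ε * f' 0 ≤ 0) := by
  rcases le_or_gt (ε * f 0) 0 with h0 | h0
  · have ha0 : 0 < a := ha.1.lt_of_ne (by rintro rfl; linarith)
    obtain ⟨c, hc, hc'⟩ := exists_mem_Ioo_deriv_pos hf le_rfl ha.2 ha0 (h0.trans_lt h)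
    exact .inl ⟨c, Ioo_subset_Icc_self hc, hc'⟩
  · rcases le_or_gt (ε * f' 0) 0 with h0' | h0'
    · exact .inr ⟨h0, h0'⟩
    · exact .inl ⟨0, ⟨le_rfl, ha.1⟩, h0'⟩

lemma exists_deriv_neg_right
    (hf : ∀ z ∈ Icc (0 : ℝ) 1, HasDerivWithinAt f (f' z) (Icc 0 1) z) {a : ℝ}
    (ha : a ∈ Icc (0 : ℝ) 1) (h : 0 < ε * f a) :
    (∃ s ∈ Icc a 1, ε * f' s < 0) ∨ (0 < ε * f 1 ∧ 0 ≤ ε * f' 1) := by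
  rcases le_or_gt (ε * f 1) 0 with h1 | h1
  · have ha1 : a < 1 := ha.2.lt_of_ne (by rintro rfl; linarith)
    obtain ⟨c, hc, hc'⟩ := exists_mem_Ioo_deriv_pos (ε := -ε) hf ha.1 le_rfl ha1 (by linarith)
    exact .inl ⟨c, Ioo_subset_Icc_self hc, by linarith⟩
  · rcases le_or_gt 0 (ε * f' 1) with h1' | h1'
    · exact .inr ⟨h1, h1'⟩
    · exact .inl ⟨1, ⟨ha.2, le_rfl⟩, h1'⟩

lemma AlternatesOn.exists_deriv
    (hf : ∀ z ∈ Icc (0 : ℝ) 1, HasDerivWithinAt f (f' z) (Icc 0 1) z) {x : ℕ → ℝ} {n : ℕ}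
    (h : AlternatesOn f (Icc 0 1) ε x (n + 1)) :
    ∃ t, AlternatesOn f' (Ioo 0 1) (-ε) t n ∧ ∀ i < n, t i ∈ Ioo (x i) (x (i + 1)) := by
  have key : ∀ i, ∃ t, i < n → t ∈ Ioo (x i) (x (i + 1)) ∧ 0 < -ε * (-1) ^ i * f' t := by
    intro i
    by_cases hi : i < n
    · have h₁ := h.1 i (by omega)
      have h₂ := h.1 (i + 1) (by omega)
      have h₃ := h₂.2
      rw [pow_succ] at h₃
      obtain ⟨t, ht, ht'⟩ := exists_mem_Ioo_deriv_pos (ε := -ε * (-1) ^ i) hf h₁.1.1 h₂.1.2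
        (h.2 i (by omega)) (by linarith [h₁.2])
      exact ⟨t, fun _ => ⟨ht, ht'⟩⟩
    · exact ⟨0, fun hi' => absurd hi' hi⟩
  choose t ht using key
  refine ⟨t, ⟨fun i hi => ⟨⟨?_, ?_⟩, (ht i hi).2⟩, fun i hi => ?_⟩, fun i hi => (ht i hi).1⟩
  · exact (h.1 i (by omega)).1.1.trans_lt (ht i hi).1.1
  · exact (ht i hi).1.2.trans_le (h.1 (i + 1) (by omega)).1.2
  · exact (ht i (by omega)).1.2.trans (ht (i + 1) hi).1.1

/-- Under Robin conditions pointing inwards at both ends, the second derivative alternates at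
least as often as the function. -/
lemma AlternatesOn.exists_deriv_deriv_of_robin {f'' : ℝ → ℝ} {c : ℝ} (hc : 0 < c)
    (hf : ∀ z ∈ Icc (0 : ℝ) 1, HasDerivWithinAt f (f' z) (Icc 0 1) z)
    (hf' : ∀ z ∈ Icc (0 : ℝ) 1, HasDerivWithinAt f' (f'' z) (Icc 0 1) z)
    (h0 : f' 0 = c * f 0) (h1 : f' 1 = -(c * f 1)) {x : ℕ → ℝ} {n : ℕ}
    (h : AlternatesOn f (Icc 0 1) ε x (n + 1)) :
    ∃ t, AlternatesOn f'' (Ioo 0 1) (-ε) t (n + 1) := by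
  obtain ⟨t, ht, htx⟩ := h.exists_deriv hf
  have hx0 := h.1 0 (by omega)
  have hxn := h.1 n (by omega)
  obtain ⟨a, ha, hfa⟩ : ∃ s ∈ Icc 0 (x 0), 0 < ε * f' s := by
    refine (exists_deriv_pos_left hf hx0.1 (by simpa using hx0.2)).resolve_right ?_
    rintro ⟨hl, hr⟩
    rw [h0] at hr
    nlinarith [mul_pos hc hl]
  obtain ⟨b, hb, hfb⟩ : ∃ s ∈ Icc (x n) 1, ε * (-1) ^ n * f' s < 0 := by
    refine (exists_deriv_neg_right hf hxn.1 hxn.2).resolve_right ?_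
    rintro ⟨hl, hr⟩
    rw [h1] at hr
    nlinarith [mul_pos hc hl]
  have hax : ∀ i < n, a < t i ∧ t i < b := fun i hi =>
    ⟨(ha.2.trans (h.le_of_le (Nat.zero_le i) (by omega))).trans_lt (htx i hi).1,
      (htx i hi).2.trans_le ((h.le_of_le (by omega : i + 1 ≤ n) (by omega)).trans hb.1)⟩
  have ha1 : a ∈ Icc (0 : ℝ) 1 := ⟨ha.1, ha.2.trans hx0.1.2⟩
  have hb1 : b ∈ Icc (0 : ℝ) 1 := ⟨hxn.1.1.trans hb.1, hb.2⟩
  have hab : a < b := by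
    rcases Nat.eq_zero_or_pos n with rfl | hn
    · refine (ha.2.trans hb.1).lt_of_ne ?_
      rintro rfl
      simp only [pow_zero, mul_one] at hfb
      linarith
    · exact (hax 0 hn).1.trans (hax 0 hn).2
  obtain ⟨r, hr⟩ := (ht.mono_set Ioo_subset_Icc_self).surround ha1 hb1 hab hax hfa
    (by rw [pow_succ]; linarith)
  obtain ⟨q, hq, -⟩ := hr.exists_deriv hf'
  exact ⟨q, hq⟩

/-- Under mixed boundary conditions involving the second derivative, the second derivative
alternates at least as often as the function. -/
lemma AlternatesOn.exists_deriv_deriv_of_mixed {f'' : ℝ → ℝ} {α β : ℝ} (hα : 0 < α) (hβ : 0 < β)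
    (hf : ∀ z ∈ Icc (0 : ℝ) 1, HasDerivWithinAt f (f' z) (Icc 0 1) z)
    (hf' : ∀ z ∈ Icc (0 : ℝ) 1, HasDerivWithinAt f' (f'' z) (Icc 0 1) z)
    (h0 : f'' 0 + α * f 0 - β * f' 0 = 0) (h1 : f'' 1 + α * f 1 + β * f' 1 = 0)
    {x : ℕ → ℝ} {n : ℕ} (h : AlternatesOn f (Icc 0 1) ε x (n + 2)) :
    ∃ t, AlternatesOn f'' (Icc 0 1) (-ε) t (n + 2) := by
  obtain ⟨t, ht, htx⟩ := h.exists_deriv hf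
  have ht' := ht.mono_set Ioo_subset_Icc_self
  obtain ⟨u, hu, hut⟩ := ht'.exists_deriv hf'
  have hx0 := h.1 0 (by omega)
  have hxn := h.1 (n + 1) (by omega)
  have ht0 := ht.1 0 (by omega)
  have htn := ht.1 n (by omega)
  simp only [pow_zero, mul_one] at ht0 hx0
  obtain ⟨a, ha, hat, hfa⟩ : ∃ s, 0 ≤ s ∧ s < t 0 ∧ 0 < -ε * f'' s := by
    rcases exists_deriv_pos_left hf hx0.1 hx0.2 with ⟨s, hs, hs'⟩ | ⟨hl, hr⟩
    · have hst := hs.2.trans_lt (htx 0 (by omega)).1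
      obtain ⟨c, hc, hc'⟩ := exists_mem_Ioo_deriv_pos (ε := -ε) hf' hs.1 ht0.1.2.le hst
        (by linarith [ht0.2])
      exact ⟨c, hs.1.trans hc.1.le, hc.2, hc'⟩
    · refine ⟨0, le_rfl, ht0.1.1, ?_⟩
      have : -ε * f'' 0 = α * (ε * f 0) - β * (ε * f' 0) := by linear_combination (-ε) * h0
      nlinarith [mul_pos hα hl, mul_nonneg hβ.le (neg_nonneg.2 hr)]
  obtain ⟨b, hb, htb, hfb⟩ : ∃ s ≤ 1, t n < s ∧ 0 < -ε * (-1) ^ (n + 1) * f'' s := by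
    have hxn2 := htn.2
    rcases exists_deriv_neg_right hf hxn.1 hxn.2 with ⟨s, hs, hs'⟩ | ⟨hl, hr⟩
    · have hst := (htx n (by omega)).2.trans_le hs.1
      rw [pow_succ] at hs'
      obtain ⟨c, hc, hc'⟩ := exists_mem_Ioo_deriv_pos (ε := -ε * (-1) ^ (n + 1)) hf'
        htn.1.1.le hs.2 hst (by rw [pow_succ]; linarith)
      exact ⟨c, hc.2.le.trans hs.2, hc.1, hc'⟩
    · refine ⟨1, le_rfl, htn.1.2, ?_⟩
      have : -ε * (-1) ^ (n + 1) * f'' 1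
          = α * (ε * (-1) ^ (n + 1) * f 1) + β * (ε * (-1) ^ (n + 1) * f' 1) := by
        linear_combination (-ε * (-1) ^ (n + 1)) * h1
      nlinarith [mul_pos hα hl, mul_nonneg hβ.le hr]
  have htt : t 0 ≤ t n := ht.le_of_le (Nat.zero_le n) (by omega)
  obtain ⟨r, hr⟩ := (hu.mono_set Ioo_subset_Icc_self).surround
    ⟨ha, (hat.trans ht0.1.2).le⟩ ⟨(htn.1.1.trans htb).le, hb⟩ (hat.trans_le htt |>.trans htb)
    (fun i hi => ⟨hat.trans ((ht.le_of_le (Nat.zero_le i) (by omega)).trans_lt (hut i hi).1),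
      (hut i hi).2.trans_le (ht.le_of_le (by omega : i + 1 ≤ n) (by omega)) |>.trans htb⟩)
    hfa hfb
  exact ⟨r, hr⟩

end DerivOnIcc

lemma ContDiffOn.hasDerivWithinAt_iteratedDerivWithin {f : ℝ → ℝ} {s : Set ℝ} {m k : ℕ}
    (hf : ContDiffOn ℝ m f s) (hs : UniqueDiffOn ℝ s) (hk : k < m) {z : ℝ} (hz : z ∈ s) :
    HasDerivWithinAt (iteratedDerivWithin k f s) (iteratedDerivWithin (k + 1) f s z) s z := by
  rw [iteratedDerivWithin_succ]
  exact (hf.differentiableOn_iteratedDerivWithin (by exact_mod_cast hk) hs z hz).hasDerivWithinAt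

theorem stmt7 (α β : ℝ) (hα : 0 < α) (hβ : 0 < β) (y : ℝ → ℝ)
    (hy : ContDiffOn ℝ 4 y (Set.Icc 0 1)) (hbc : BC α β y)
    (n : ℕ) (hsc : SignChanges y n) :
    SignChanges (iteratedDerivWithin 4 y (Set.Icc 0 1)) n := by
  rcases Nat.eq_zero_or_pos n with rfl | hn
  · exact ⟨fun _ => 1 / 2, fun i j hij => absurd hij (by omega), fun _ => by norm_num, fun i => i.elim0⟩
  obtain ⟨h0, h0', h1, h1'⟩ := hbc
  have hd : ∀ k < 4, ∀ z ∈ Icc (0 : ℝ) 1, HasDerivWithinAt (iteratedDerivWithin k y (Icc 0 1))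
      (iteratedDerivWithin (k + 1) y (Icc 0 1) z) (Icc 0 1) z := fun k hk z hz =>
    ContDiffOn.hasDerivWithinAt_iteratedDerivWithin (m := 4) (by exact_mod_cast hy)
      uniqueDiffOn_Icc_zero_one hk hz
  have hd0 := hd 0 (by norm_num)
  have hd1 := hd 1 (by norm_num)
  rw [iteratedDerivWithin_zero] at hd0
  simp only [zero_add, iteratedDerivWithin_one] at hd0 hd1
  obtain ⟨ε, x, hx⟩ := hsc.exists_alternatesOn hn
  obtain ⟨m, rfl⟩ : ∃ m, n = m + 1 := ⟨n - 1, by omega⟩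
  obtain ⟨t, ht⟩ := (hx.mono_set Ioo_subset_Icc_self).exists_deriv_deriv_of_mixed hα hβ
    hd0 hd1 h0 h1
  obtain ⟨q, hq⟩ := ht.exists_deriv_deriv_of_robin (div_pos hα hβ)
    (hd 2 (by norm_num)) (hd 3 (by norm_num))
    (by change Y3 y 0 = α / β * Y2 y 0; field_simp; linarith)
    (by change Y3 y 1 = -(α / β * Y2 y 1); field_simp; linarith)
  exact hq.signChanges
end
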